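/- Let β ∈ {1,−1} and R > 0. There exist ε > 0 and C > 0 such that for every C¹ function f₀ : ℝ³×ℝ³ → [0,∞) supported in {(x,v) : |x| ≤ R, |v| ≤ R} with ‖f₀‖_{C¹} ≤ ε, there exists a global classical solution f of the Vlasov–Poisson system with parameter β and initial datum f(0,·,·) = f₀, and the induced density satisfies the decay estimate sup_{x∈ℝ³} ρ(t,x) ≤ C(1+t)^{−3} for all t ≥ 0 (Bardos–Degond small data global existence). -/

import Mathlib

open MeasureTheory Real Bornology

noncomputable section

/-- Three-dimensional Euclidean space. -/
abbrev E3 := EuclideanSpace ℝ (Fin 3)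

/-- The spatial density `ρ(t,x) = ∫ f(t,x,v) dv` induced by a distribution
function `F` on `ℝ × ℝ³ × ℝ³`. -/
def vpDensity (F : ℝ × E3 × E3 → ℝ) (t : ℝ) (x : E3) : ℝ :=
  ∫ v : E3, F (t, x, v)

/-- The field `E(t,x) = (1/4π) ∫ ρ(t,y)(x−y)/|x−y|³ dy` (so `E = ∇φ`, `Δφ = ρ`). -/
def vpField (F : ℝ × E3 × E3 → ℝ) (t : ℝ) (x : E3) : E3 :=
  (4 * π)⁻¹ • ∫ y : E3, (vpDensity F t y / ‖x - y‖ ^ 3) • (x - y)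

/-- `F` is a global classical solution of the (nonrelativistic) Vlasov–Poisson
system with parameter `β`: it is a nonnegative `C¹` function, it satisfies
`∂_t f + v·∇_x f + β E·∇_v f = 0` pointwise for `t ≥ 0`, and for each `t` the
set `{(s,x,v) : 0 ≤ s ≤ t, f(s,x,v) ≠ 0}` is bounded. -/
structure IsGlobalVPSolution (β : ℝ) (F : ℝ × E3 × E3 → ℝ) : Prop where
  nonneg : ∀ z, 0 ≤ F z
  smooth : ContDiff ℝ 1 F
  pde : ∀ t x v, 0 ≤ t →
    fderiv ℝ F (t, x, v) (1, v, β • vpField F t x) = 0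
  support_bounded : ∀ t, 0 ≤ t →
    IsBounded {z : ℝ × E3 × E3 | 0 ≤ z.1 ∧ z.1 ≤ t ∧ F z ≠ 0}

/-- The momentum support function
`Q(t) = sup{|v| : ∃ s ∈ [0,t], x ∈ ℝ³, f(s,x,v) ≠ 0}`. -/
def vpQ (F : ℝ × E3 × E3 → ℝ) (t : ℝ) : ℝ :=
  sSup {r : ℝ | ∃ s x v, 0 ≤ s ∧ s ≤ t ∧ F (s, x, v) ≠ 0 ∧ r = ‖v‖}


open Filter Topology



/-! ## Part 1: integrals over the unit interval and Volterra equations -/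

/-- Time weight `(1+|t|)^{-5/2}`. -/
def wt (t : ℝ) : ℝ := ((1 + |t|) ^ 2 * √(1 + |t|))⁻¹

/-- Time weight `(1+|t|)^{-2}`. -/
def w2 (t : ℝ) : ℝ := ((1 + |t|) ^ 2)⁻¹

lemma wt_pos (t : ℝ) : 0 < wt t := by unfold wt; positivity

lemma w2_pos (t : ℝ) : 0 < w2 t := by unfold w2; positivity

lemma wt_le_w2 (t : ℝ) : wt t ≤ w2 t := by
  unfold wt w2
  apply inv_anti₀ (by positivity)
  have : 1 ≤ √(1 + |t|) := by
    rw [Real.one_le_sqrt]; linarith [abs_nonneg t]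
  nlinarith [sq_nonneg (1 + |t|)]

lemma w2_le_one (t : ℝ) : w2 t ≤ 1 := by
  unfold w2
  apply inv_le_one_of_one_le₀
  nlinarith [abs_nonneg t]

lemma wt_cont : Continuous wt := by
  unfold wt
  apply Continuous.inv₀ (by fun_prop)
  intro t; positivity

lemma w2_cont : Continuous w2 := by
  unfold w2
  apply Continuous.inv₀ (by fun_prop)
  intro t; positivity

lemma ui_integral {B : Type*} [NormedAddCommGroup B] [NormedSpace ℝ B] (g : ℝ → B) :
    ∫ η : unitInterval, g η = ∫ x in (0 : ℝ)..1, g x := by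
  rw [integral_subtype measurableSet_Icc, integral_Icc_eq_integral_Ioc,
    intervalIntegral.integral_of_le zero_le_one]

lemma ui_integrable {B : Type*} [NormedAddCommGroup B] {g : unitInterval → B}
    (hg : Continuous g) : Integrable g :=
  hg.integrable_of_hasCompactSupport (HasCompactSupport.of_compactSpace g)

lemma w2_int (t : ℝ) : |t| * ∫ η : unitInterval, w2 (t * η) ≤ 1 := by
  rw [ui_integral (fun x => w2 (t * x)), ← intervalIntegral.integral_const_mul]
  have h : ∀ x ∈ Set.uIcc (0 : ℝ) 1,
      HasDerivAt (fun x => -(1 + |t| * x)⁻¹) (|t| * w2 (t * x)) x := by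
    intro x hx
    rw [Set.uIcc_of_le zero_le_one] at hx
    have hp : 0 < 1 + |t| * x := by have := mul_nonneg (abs_nonneg t) hx.1; linarith
    have h1 : HasDerivAt (fun x => 1 + |t| * x) (|t|) x := by
      simpa using ((hasDerivAt_id x).const_mul |t|).const_add 1
    have := (h1.inv hp.ne').neg
    refine HasDerivAt.congr_deriv this ?_
    unfold w2
    rw [abs_mul, abs_of_nonneg hx.1]
    field_simp
  rw [intervalIntegral.integral_eq_sub_of_hasDerivAt h]
  · simp
    positivity
  · exact (Continuous.mul continuous_const
      (w2_cont.comp (by fun_prop))).intervalIntegrable _ _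

lemma wt_int (t : ℝ) : |t| * ∫ η : unitInterval, wt (t * η) ≤ 1 := by
  refine le_trans ?_ (w2_int t)
  apply mul_le_mul_of_nonneg_left _ (abs_nonneg t)
  apply integral_mono
  · exact ui_integrable (wt_cont.comp (by fun_prop))
  · exact ui_integrable (w2_cont.comp (by fun_prop))
  · intro η; exact wt_le_w2 _

lemma wt_int2 (t : ℝ) : t ^ 2 * ∫ η : unitInterval, (η : ℝ) * wt (t * η) ≤ 2 := by
  rw [ui_integral (fun x => x * wt (t * x)), ← intervalIntegral.integral_const_mul]
  have hcs : ContinuousOn (fun x => |t| * ((1 + |t| * x)⁻¹ * (√(1 + |t| * x))⁻¹))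
      (Set.uIcc (0 : ℝ) 1) := by
    rw [Set.uIcc_of_le zero_le_one]
    have hp : ∀ x ∈ Set.Icc (0 : ℝ) 1, 0 < 1 + |t| * x := fun x hx => by
      have := mul_nonneg (abs_nonneg t) hx.1; linarith
    apply ContinuousOn.mul continuousOn_const
    apply ContinuousOn.mul
    · exact ContinuousOn.inv₀ (by fun_prop) (fun x hx => (hp x hx).ne')
    · exact ContinuousOn.inv₀ (by fun_prop) (fun x hx => (Real.sqrt_pos.2 (hp x hx)).ne')
  have h : ∀ x ∈ Set.uIcc (0 : ℝ) 1,
      HasDerivAt (fun x => -2 * (√(1 + |t| * x))⁻¹)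
        (|t| * ((1 + |t| * x)⁻¹ * (√(1 + |t| * x))⁻¹)) x := by
    intro x hx
    rw [Set.uIcc_of_le zero_le_one] at hx
    have hp : 0 < 1 + |t| * x := by have := mul_nonneg (abs_nonneg t) hx.1; linarith
    have h1 : HasDerivAt (fun x => 1 + |t| * x) (|t|) x := by
      simpa using ((hasDerivAt_id x).const_mul |t|).const_add 1
    have := ((h1.sqrt hp.ne').inv (Real.sqrt_pos.2 hp).ne').const_mul (-2)
    refine HasDerivAt.congr_deriv this ?_
    rw [Real.sq_sqrt hp.le]
    field_simp
  have h2 := intervalIntegral.integral_eq_sub_of_hasDerivAt h hcs.intervalIntegrable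
  calc _ ≤ ∫ x in (0 : ℝ)..1, |t| * ((1 + |t| * x)⁻¹ * (√(1 + |t| * x))⁻¹) := by
        apply intervalIntegral.integral_mono_on zero_le_one
        · exact (Continuous.mul continuous_const
            (Continuous.mul continuous_id (wt_cont.comp (by fun_prop)))).intervalIntegrable _ _
        · exact hcs.intervalIntegrable
        · intro x hx
          have hp : 0 ≤ |t| * x := mul_nonneg (abs_nonneg t) hx.1
          unfold wt
          rw [abs_mul, abs_of_nonneg hx.1, ← sq_abs t]
          have hs : 0 < √(1 + |t| * x) := Real.sqrt_pos.2 (by linarith)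
          have e : |t| ^ 2 * (x * ((1 + |t| * x) ^ 2 * √(1 + |t| * x))⁻¹)
            = |t| * ((1 + |t| * x)⁻¹ * (√(1 + |t| * x))⁻¹) * ((|t| * x) / (1 + |t| * x)) := by
            field_simp
          rw [e]
          apply mul_le_of_le_one_right (by positivity)
          rw [div_le_one (by positivity)]; linarith
    _ ≤ 2 := by
        rw [h2]; simp

/-- Volterra kernel. -/
def kk (σ η : unitInterval) : ℝ := max ((η : ℝ) - σ) 0

lemma kk_nonneg (σ η : unitInterval) : 0 ≤ kk σ η := le_max_right _ _

lemma kk_le (σ η : unitInterval) : kk σ η ≤ η := by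
  unfold kk; exact max_le (by linarith [σ.2.1]) η.2.1

lemma kk_le_one (σ η : unitInterval) : kk σ η ≤ 1 := (kk_le σ η).trans η.2.2

lemma kk_cont : Continuous (fun p : unitInterval × unitInterval => kk p.1 p.2) := by
  unfold kk; fun_prop

section
variable {B : Type*} [NormedAddCommGroup B] [NormedSpace ℝ B]

lemma ui_norm_le {u : unitInterval → B} {g : unitInterval → ℝ} (hg : Continuous g)
    (h : ∀ η, ‖u η‖ ≤ g η) : ‖∫ η, u η‖ ≤ ∫ η, g η :=
  norm_integral_le_of_norm_le (ui_integrable hg) (Eventually.of_forall h)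

lemma kk_bound_wt {u : unitInterval → B} {t M : ℝ} (hM : 0 ≤ M)
    (h : ∀ η : unitInterval, ‖u η‖ ≤ M * wt (t * η)) (σ : unitInterval) :
    ‖t ^ 2 • ∫ η, kk σ η • u η‖ ≤ 2 * M := by
  have h1 : ‖∫ η, kk σ η • u η‖ ≤ ∫ η : unitInterval, M * ((η : ℝ) * wt (t * η)) := by
    apply ui_norm_le
    · exact continuous_const.mul (Continuous.mul (by fun_prop) (wt_cont.comp (by fun_prop)))
    · intro η
      rw [norm_smul, Real.norm_of_nonneg (kk_nonneg _ _)]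
      have := mul_le_mul (kk_le σ η) (h η) (norm_nonneg _) η.2.1
      linarith
  rw [integral_const_mul] at h1
  rw [norm_smul, Real.norm_of_nonneg (sq_nonneg t)]
  have h2 := wt_int2 t
  calc _ ≤ t ^ 2 * (M * ∫ η : unitInterval, (η : ℝ) * wt (t * η)) := by gcongr
    _ = M * (t ^ 2 * ∫ η : unitInterval, (η : ℝ) * wt (t * η)) := by ring
    _ ≤ M * 2 := by gcongr
    _ = _ := by ring

lemma bound_wt {u : unitInterval → B} {t M : ℝ} (hM : 0 ≤ M)
    (h : ∀ η : unitInterval, ‖u η‖ ≤ M * wt (t * η)) :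
    ‖t • ∫ η, u η‖ ≤ M := by
  have h1 : ‖∫ η, u η‖ ≤ ∫ η : unitInterval, M * wt (t * η) := by
    apply ui_norm_le
    · exact continuous_const.mul (wt_cont.comp (by fun_prop))
    · exact h
  rw [integral_const_mul] at h1
  rw [norm_smul, Real.norm_eq_abs]
  have h2 := wt_int t
  calc _ ≤ |t| * (M * ∫ η : unitInterval, wt (t * η)) := by gcongr
    _ = M * (|t| * ∫ η : unitInterval, wt (t * η)) := by ring
    _ ≤ M * 1 := by gcongr
    _ = _ := by ring

lemma bound_w2 {u : unitInterval → B} {t M : ℝ} (hM : 0 ≤ M)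
    (h : ∀ η : unitInterval, ‖u η‖ ≤ M * w2 (t * η)) :
    ‖t • ∫ η, u η‖ ≤ M := by
  have h1 : ‖∫ η, u η‖ ≤ ∫ η : unitInterval, M * w2 (t * η) := by
    apply ui_norm_le
    · exact continuous_const.mul (w2_cont.comp (by fun_prop))
    · exact h
  rw [integral_const_mul] at h1
  rw [norm_smul, Real.norm_eq_abs]
  have h2 := w2_int t
  calc _ ≤ |t| * (M * ∫ η : unitInterval, w2 (t * η)) := by gcongr
    _ = M * (|t| * ∫ η : unitInterval, w2 (t * η)) := by ring
    _ ≤ M * 1 := by gcongr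
    _ = _ := by ring

lemma kk_bound_w2 {u : unitInterval → B} {t M : ℝ} (hM : 0 ≤ M)
    (h : ∀ η : unitInterval, ‖u η‖ ≤ M * w2 (t * η)) (σ : unitInterval) :
    ‖t ^ 2 • ∫ η, kk σ η • u η‖ ≤ |t| * M := by
  have h1 : ‖t • ∫ η, kk σ η • u η‖ ≤ M := by
    apply bound_w2 hM
    intro η
    rw [norm_smul, Real.norm_of_nonneg (kk_nonneg _ _)]
    have := mul_le_mul (kk_le_one σ η) (h η) (norm_nonneg _) zero_le_one
    linarith
  rw [sq, mul_smul, norm_smul, Real.norm_eq_abs]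
  gcongr

lemma bound_const {u : unitInterval → B} {d : ℝ}
    (h : ∀ η : unitInterval, ‖u η‖ ≤ d) : ‖∫ η, u η‖ ≤ d := by
  have := norm_integral_le_of_norm_le_const (μ := (volume : Measure unitInterval))
    (Eventually.of_forall h)
  simpa using this

lemma kk_bound_const {u : unitInterval → B} {d : ℝ}
    (h : ∀ η : unitInterval, ‖u η‖ ≤ d) (σ : unitInterval) : ‖∫ η, kk σ η • u η‖ ≤ d := by
  apply bound_const
  intro η
  rw [norm_smul, Real.norm_of_nonneg (kk_nonneg _ _)]
  have := mul_le_mul (kk_le_one σ η) (h η) (norm_nonneg _) zero_le_one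
  linarith

lemma cont_param {X : Type*} [TopologicalSpace X] [FirstCountableTopology X]
    [LocallyCompactSpace X] {f : X → unitInterval → B}
    (hf : Continuous (fun p : X × unitInterval => f p.1 p.2)) :
    Continuous (fun x => ∫ η, f x η) := by
  have := continuous_parametric_integral_of_continuous (μ := (volume : Measure unitInterval))
    (f := f) hf isCompact_univ
  simpa using this

/-- Parametrized fixed points depend continuously on parameters. -/
lemma param_fix {X P : Type*} [MetricSpace X] [CompleteSpace X] [Nonempty X]
    [TopologicalSpace P] (Φ : P → X → X)
    (hΦ : ∀ p x y, dist (Φ p x) (Φ p y) ≤ 1 / 2 * dist x y)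
    (hc : ∀ x, Continuous (fun p => Φ p x)) :
    ∃ y : P → X, Continuous y ∧ (∀ p, Φ p (y p) = y p) ∧ ∀ p x, Φ p x = x → x = y p := by
  have hcw : ∀ p, ContractingWith (1 / 2 : NNReal) (Φ p) := by
    intro p
    refine ⟨?_, LipschitzWith.of_dist_le_mul ?_⟩
    · rw [← NNReal.coe_lt_coe]; norm_num
    · intro x y; simpa using hΦ p x y
  refine ⟨fun p => (hcw p).fixedPoint, ?_, fun p => (hcw p).fixedPoint_isFixedPt,
    fun p x hx => (hcw p).fixedPoint_unique hx⟩
  rw [continuous_iff_continuousAt]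
  intro p
  rw [ContinuousAt, tendsto_iff_dist_tendsto_zero]
  set y := fun p => (hcw p).fixedPoint
  have hfix : ∀ p, Φ p (y p) = y p := fun p => (hcw p).fixedPoint_isFixedPt
  have hb : ∀ q, dist (y q) (y p) ≤ 2 * dist (Φ q (y p)) (Φ p (y p)) := by
    intro q
    have h1 := dist_triangle (Φ q (y q)) (Φ q (y p)) (Φ p (y p))
    have h2 := hΦ q (y q) (y p)
    rw [hfix, hfix] at h1
    rw [hfix] at h2 ⊢
    linarith
  have h0 : Tendsto (fun q => 2 * dist (Φ q (y p)) (Φ p (y p))) (𝓝 p) (𝓝 0) := by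
    have h1 : Continuous (fun q => 2 * dist (Φ q (y p)) (Φ p (y p))) :=
      continuous_const.mul ((hc (y p)).dist continuous_const)
    have := h1.tendsto p
    simpa using this
  exact squeeze_zero (fun q => dist_nonneg) hb h0

/-- Volterra fixed point with parameters. -/
lemma volterra_fix [CompleteSpace B] {P : Type*} [TopologicalSpace P] [FirstCountableTopology P]
    [LocallyCompactSpace P] (t : P → ℝ) (ht : Continuous t)
    (a : P → unitInterval → B) (ha : Continuous (fun p : P × unitInterval => a p.1 p.2))
    (g : P → unitInterval → B → B)
    (hg : Continuous (fun p : P × unitInterval × B => g p.1 p.2.1 p.2.2))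
    (hl : ∀ p η b b', ‖g p η b - g p η b'‖ ≤ 1 / 4 * wt (t p * η) * ‖b - b'‖) :
    ∃ y : P → C(unitInterval, B), Continuous y ∧
      (∀ p σ, y p σ = a p σ + t p ^ 2 • ∫ η, kk σ η • g p η (y p η)) ∧
      (∀ p (x : C(unitInterval, B)),
        (∀ σ, x σ = a p σ + t p ^ 2 • ∫ η, kk σ η • g p η (x η)) → x = y p) := by
  have hjc : ∀ x : C(unitInterval, B), Continuous (fun q : P × unitInterval =>
      a q.1 q.2 + t q.1 ^ 2 • ∫ η, kk q.2 η • g q.1 η (x η)) := by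
    intro x
    refine ha.add (((ht.comp continuous_fst).pow 2).smul ?_)
    apply cont_param (f := fun (q : P × unitInterval) η => kk q.2 η • g q.1 η (x η))
    refine Continuous.smul ?_ ?_
    · exact kk_cont.comp (by fun_prop : Continuous
        (fun p : (P × unitInterval) × unitInterval => (p.1.2, p.2)))
    · exact hg.comp (by fun_prop : Continuous
        (fun p : (P × unitInterval) × unitInterval => (p.1.1, p.2, x p.2)))
  let Φ : P → C(unitInterval, B) → C(unitInterval, B) := fun p x =>
    ⟨fun σ => a p σ + t p ^ 2 • ∫ η, kk σ η • g p η (x η),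
      (hjc x).comp (by fun_prop : Continuous (fun σ : unitInterval => (p, σ)))⟩
  obtain ⟨y, hy, hf, hu⟩ := param_fix Φ (by
    intro p x x'
    rw [ContinuousMap.dist_le (by positivity)]
    intro σ
    have hi : ∀ x : C(unitInterval, B), Integrable (fun η => kk σ η • g p η (x η)) := by
      intro x
      apply ui_integrable
      refine Continuous.smul ?_ ?_
      · exact kk_cont.comp (by fun_prop : Continuous (fun η : unitInterval => (σ, η)))
      · exact hg.comp (by fun_prop : Continuous (fun η : unitInterval => (p, η, x η)))
    have e : Φ p x σ - Φ p x' σ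
        = t p ^ 2 • ∫ η, kk σ η • (g p η (x η) - g p η (x' η)) := by
      simp only [Φ, ContinuousMap.coe_mk, smul_sub]
      rw [integral_sub (hi x) (hi x'), smul_sub]
      abel
    rw [dist_eq_norm, e]
    have := kk_bound_wt (t := t p) (M := 1 / 4 * dist x x')
      (u := fun η => g p η (x η) - g p η (x' η)) (by positivity) (by
        intro η
        refine (hl p η _ _).trans ?_
        have h1 : ‖x η - x' η‖ ≤ dist x x' := by
          rw [← dist_eq_norm]; exact ContinuousMap.dist_apply_le_dist η
        have h2 := wt_pos (t p * η)
        calc _ ≤ 1 / 4 * wt (t p * η) * dist x x' := by gcongr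
          _ = _ := by ring) σ
    linarith) (by
    intro x
    apply ContinuousMap.continuous_of_continuous_uncurry
    exact hjc x)
  refine ⟨y, hy, fun p σ => ?_, fun p x hx => hu p x ?_⟩
  · conv_lhs => rw [← hf p]
    rfl
  · ext σ; exact (hx σ).symm

lemma half_trick {u : C(unitInterval, B)} {m : ℝ} (h : ∀ σ, ‖u σ‖ ≤ m + 1 / 2 * ‖u‖) :
    ‖u‖ ≤ 2 * m := by
  have hm : 0 ≤ m + 1 / 2 * ‖u‖ := (norm_nonneg _).trans (h 0)
  have := (ContinuousMap.norm_le u hm).2 h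
  linarith

end


/-! ## Part 2: characteristics of a good field -/

/-- A decaying Lipschitz force field. -/
structure GoodField (δ : ℝ) (B : ℝ × E3 → E3) : Prop where
  cont : Continuous B
  bd : ∀ t x, ‖B (t, x)‖ ≤ δ * w2 t
  lip : ∀ t x y, ‖B (t, x) - B (t, y)‖ ≤ δ * wt t * ‖x - y‖

/-- `Y` is the family of rescaled characteristics `σ ↦ X(σ t; t, x, v)` of `B`. -/
structure IsFlow (B : ℝ × E3 → E3) (Y : ℝ × E3 × E3 → C(unitInterval, E3)) : Prop where
  cont : Continuous Y
  eq : ∀ (p : ℝ × E3 × E3) (σ : unitInterval), Y p σ = (p.2.1 + (((σ : ℝ) - 1) * p.1) • p.2.2) +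
    p.1 ^ 2 • ∫ η, kk σ η • B (p.1 * η, Y p η)
  uniq : ∀ (p : ℝ × E3 × E3) (x : C(unitInterval, E3)),
    (∀ σ : unitInterval, x σ = (p.2.1 + (((σ : ℝ) - 1) * p.1) • p.2.2) +
      p.1 ^ 2 • ∫ η, kk σ η • B (p.1 * η, x η)) → x = Y p

/-- The rescaled characteristics. -/
def flowY (B : ℝ × E3 → E3) : ℝ × E3 × E3 → C(unitInterval, E3) :=
  Classical.epsilon (IsFlow B)

lemma GoodField.isFlow {δ : ℝ} {B : ℝ × E3 → E3} (h : GoodField δ B) (hδ : δ ≤ 1 / 8) :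
    IsFlow B (flowY B) := by
  apply Classical.epsilon_spec (p := IsFlow B)
  obtain ⟨y, h1, h2, h3⟩ := volterra_fix (P := ℝ × E3 × E3) (B := E3) (fun p => p.1)
    continuous_fst (fun p σ => (p.2.1 + (((σ : ℝ) - 1) * p.1) • p.2.2)) (by fun_prop)
    (fun p η b => B (p.1 * η, b)) (h.cont.comp (by fun_prop)) (by
      intro p η b b'
      refine (h.lip _ _ _).trans ?_
      have := (wt_pos (p.1 * η)).le
      gcongr
      linarith)
  exact ⟨y, h1, h2, h3⟩

/-- Initial position. -/
def X0 (B : ℝ × E3 → E3) (p : ℝ × E3 × E3) : E3 := flowY B p 0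

/-- Initial velocity. -/
def V0 (B : ℝ × E3 → E3) (p : ℝ × E3 × E3) : E3 :=
  p.2.2 - p.1 • ∫ η : unitInterval, B (p.1 * η, flowY B p η)

/-- The transported datum. -/
def FF (f₀ : E3 × E3 → ℝ) (B : ℝ × E3 → E3) (p : ℝ × E3 × E3) : ℝ := f₀ (X0 B p, V0 B p)

section
variable {δ : ℝ} {B B' : ℝ × E3 → E3}

lemma GoodField.path_cont (h : GoodField δ B) (t : ℝ) (y : C(unitInterval, E3)) :
    Continuous (fun η : unitInterval => B (t * η, y η)) := h.cont.comp (by fun_prop)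

lemma GoodField.kpath_cont (h : GoodField δ B) (t : ℝ) (y : C(unitInterval, E3))
    (σ : unitInterval) :
    Continuous (fun η : unitInterval => kk σ η • B (t * η, y η)) :=
  (kk_cont.comp (by fun_prop : Continuous (fun η : unitInterval => (σ, η)))).smul
    (h.path_cont t y)

lemma GoodField.delta_nonneg (h : GoodField δ B) : 0 ≤ δ := by
  have h1 := (norm_nonneg _).trans (h.bd 0 0)
  have h2 := w2_pos 0
  by_contra hc
  push Not at hc
  nlinarith

lemma flow_joint_cont (h : GoodField δ B) (hδ : δ ≤ 1 / 8) :
    Continuous (fun q : (ℝ × E3 × E3) × unitInterval => flowY B q.1 q.2) := by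
  have := (h.isFlow hδ).cont
  fun_prop

lemma X0_cont (h : GoodField δ B) (hδ : δ ≤ 1 / 8) : Continuous (X0 B) :=
  (flow_joint_cont h hδ).comp (by fun_prop : Continuous (fun p : ℝ × E3 × E3 => (p, (0 : unitInterval))))

lemma V0_cont (h : GoodField δ B) (hδ : δ ≤ 1 / 8) : Continuous (V0 B) := by
  unfold V0
  refine Continuous.sub (by fun_prop) (Continuous.smul continuous_fst ?_)
  apply cont_param (f := fun (p : ℝ × E3 × E3) (η : unitInterval) => B (p.1 * η, flowY B p η))
  apply h.cont.comp
  exact Continuous.prodMk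
    (by fun_prop : Continuous (fun q : (ℝ × E3 × E3) × unitInterval => q.1.1 * (q.2 : ℝ)))
    (flow_joint_cont h hδ)

lemma FF_cont (h : GoodField δ B) (hδ : δ ≤ 1 / 8) {f₀ : E3 × E3 → ℝ} (hf : Continuous f₀) :
    Continuous (FF f₀ B) :=
  hf.comp ((X0_cont h hδ).prodMk (V0_cont h hδ))

lemma V0_sub (h : GoodField δ B) (t : ℝ) (x v : E3) :
    ‖V0 B (t, x, v) - v‖ ≤ δ := by
  have e : V0 B (t, x, v) - v = - (t • ∫ η : unitInterval, B (t * η, flowY B (t, x, v) η)) := by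
    simp [V0]
  rw [e, norm_neg]
  exact bound_w2 h.delta_nonneg (fun η => h.bd _ _)

lemma X0_sub (h : GoodField δ B) (hδ : δ ≤ 1 / 8) (t : ℝ) (x v : E3) :
    ‖X0 B (t, x, v) - (x - t • v)‖ ≤ |t| * δ := by
  have e : X0 B (t, x, v) - (x - t • v)
      = t ^ 2 • ∫ η, kk 0 η • B (t * η, flowY B (t, x, v) η) := by
    rw [X0, (h.isFlow hδ).eq]
    simp
    abel
  rw [e]
  exact kk_bound_w2 h.delta_nonneg (fun η => h.bd _ _) 0

lemma supp_bound (h : GoodField δ B) (hδ : δ ≤ 1 / 8) {R : ℝ} {f₀ : E3 × E3 → ℝ}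
    (hs : ∀ x v : E3, f₀ (x, v) ≠ 0 → ‖x‖ ≤ R ∧ ‖v‖ ≤ R) {t : ℝ} {x v : E3}
    (hF : FF f₀ B (t, x, v) ≠ 0) : ‖v‖ ≤ R + 1 ∧ ‖x‖ ≤ (R + 2) * (1 + |t|) := by
  obtain ⟨h1, h2⟩ := hs _ _ hF
  have h3 := V0_sub h t x v
  have h4 := X0_sub h hδ t x v
  have hv : ‖v‖ ≤ R + 1 := by
    have := norm_sub_norm_le v (V0 B (t, x, v))
    rw [norm_sub_rev] at this
    linarith
  refine ⟨hv, ?_⟩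
  have h5 : ‖x - t • v‖ ≤ R + |t| * δ := by
    have := norm_sub_norm_le (x - t • v) (X0 B (t, x, v))
    rw [norm_sub_rev (x - t • v)] at this
    linarith
  have h6 : ‖x‖ ≤ ‖x - t • v‖ + |t| * ‖v‖ := by
    have := norm_add_le (x - t • v) (t • v)
    rw [norm_smul, Real.norm_eq_abs] at this
    simpa using this
  have h7 : |t| * ‖v‖ ≤ |t| * (R + 1) := by gcongr
  have h8 : |t| * δ ≤ |t| * 1 := by gcongr; linarith
  nlinarith [abs_nonneg t]

/-- Difference of two characteristics with the same time. -/
lemma flow_sub (h : GoodField δ B) (h' : GoodField δ B') (hδ : δ ≤ 1 / 8) (t : ℝ)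
    (x v x' v' : E3) (σ : unitInterval) :
    flowY B (t, x, v) σ - flowY B' (t, x', v') σ
      = (x - x' + (((σ : ℝ) - 1) * t) • (v - v')) + t ^ 2 • ∫ η, kk σ η •
        (B (t * η, flowY B (t, x, v) η) - B' (t * η, flowY B' (t, x', v') η)) := by
  rw [(h.isFlow hδ).eq, (h'.isFlow hδ).eq]
  simp only [smul_sub]
  rw [integral_sub (ui_integrable (h.kpath_cont _ _ _)) (ui_integrable (h'.kpath_cont _ _ _))]
  simp only [smul_sub]
  abel

lemma V0_diff (h : GoodField δ B) (h' : GoodField δ B') (t : ℝ)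
    (x v x' v' : E3) :
    V0 B (t, x, v) - V0 B' (t, x', v')
      = (v - v') - t • ∫ η : unitInterval,
        (B (t * η, flowY B (t, x, v) η) - B' (t * η, flowY B' (t, x', v') η)) := by
  simp only [V0]
  rw [integral_sub (ui_integrable (h.path_cont _ _)) (ui_integrable (h'.path_cont _ _))]
  simp only [smul_sub]
  abel

lemma lip_path (h : GoodField δ B) (t : ℝ) (y y' : C(unitInterval, E3)) (η : unitInterval) :
    ‖B (t * η, y η) - B (t * η, y' η)‖ ≤ (δ * ‖y - y'‖) * wt (t * η) := by
  refine (h.lip _ _ _).trans ?_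
  have h1 : ‖y η - y' η‖ ≤ ‖y - y'‖ := (y - y').norm_coe_le_norm η
  have h2 := wt_pos (t * η)
  have h3 := h.delta_nonneg
  calc _ ≤ δ * wt (t * η) * ‖y - y'‖ := by gcongr
    _ = _ := by ring

lemma flow_z_dep (h : GoodField δ B) (hδ : δ ≤ 1 / 8) (t : ℝ) (x v x' v' : E3) :
    ‖flowY B (t, x, v) - flowY B (t, x', v')‖ ≤ 2 * (‖x - x'‖ + |t| * ‖v - v'‖) := by
  apply half_trick
  intro σ
  rw [ContinuousMap.sub_apply, flow_sub h h hδ]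
  have h1 := kk_bound_wt (mul_nonneg h.delta_nonneg (norm_nonneg _))
    (lip_path h t (flowY B (t, x, v)) (flowY B (t, x', v'))) σ
  refine (norm_add_le _ _).trans ?_
  have h2 := norm_add_le (x - x') ((((σ : ℝ) - 1) * t) • (v - v'))
  rw [norm_smul, norm_mul, Real.norm_eq_abs t] at h2
  have h3 : ‖(σ : ℝ) - 1‖ ≤ 1 := by
    rw [Real.norm_eq_abs, abs_le]; constructor <;> linarith [σ.2.1, σ.2.2]
  have h4 : ‖(σ : ℝ) - 1‖ * |t| * ‖v - v'‖ ≤ 1 * |t| * ‖v - v'‖ := by gcongr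
  have h5 := norm_nonneg (flowY B (t, x, v) - flowY B (t, x', v'))
  nlinarith

lemma v_dep (h : GoodField δ B) (hδ : δ ≤ 1 / 8) (t : ℝ) (x v v' : E3) :
    |t| * ‖v - v'‖ ≤ 2 * ‖X0 B (t, x, v) - X0 B (t, x, v')‖ := by
  have h0 := flow_z_dep h hδ t x v x v'
  have h1 := kk_bound_wt (mul_nonneg h.delta_nonneg (norm_nonneg _))
    (lip_path h t (flowY B (t, x, v)) (flowY B (t, x, v'))) 0
  have h2 := flow_sub h h hδ t x v x v' 0
  have e : t • (v - v') = (t ^ 2 • ∫ η, kk 0 η •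
        (B (t * η, flowY B (t, x, v) η) - B (t * η, flowY B (t, x, v') η)))
        - (X0 B (t, x, v) - X0 B (t, x, v')) := by
    simp only [X0]
    rw [h2]; simp
  have h3 := norm_sub_le (t ^ 2 • ∫ η, kk 0 η •
        (B (t * η, flowY B (t, x, v) η) - B (t * η, flowY B (t, x, v') η)))
        (X0 B (t, x, v) - X0 B (t, x, v'))
  rw [← e, norm_smul, Real.norm_eq_abs] at h3
  rw [sub_self, norm_zero] at h0
  have h5 := norm_nonneg (flowY B (t, x, v) - flowY B (t, x, v'))
  have h6 := h.delta_nonneg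
  nlinarith

lemma v_supp (h : GoodField δ B) (hδ : δ ≤ 1 / 8) {R : ℝ} {f₀ : E3 × E3 → ℝ}
    (hs : ∀ x v : E3, f₀ (x, v) ≠ 0 → ‖x‖ ≤ R ∧ ‖v‖ ≤ R) {t : ℝ} {x v v' : E3}
    (hF : FF f₀ B (t, x, v) ≠ 0) (hF' : FF f₀ B (t, x, v') ≠ 0) :
    ‖v - v'‖ ≤ (6 * R + 2) / (1 + |t|) := by
  have h1 := (supp_bound h hδ hs hF).1
  have h2 := (supp_bound h hδ hs hF').1
  have h3 := (hs _ _ hF).1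
  have h4 := (hs _ _ hF').1
  have h5 := v_dep h hδ t x v v'
  have h6 := norm_sub_le (X0 B (t, x, v)) (X0 B (t, x, v'))
  have h7 := norm_sub_le v v'
  rw [le_div_iff₀ (by positivity)]
  nlinarith

lemma x_dep (h : GoodField δ B) (hδ : δ ≤ 1 / 8) (t : ℝ) (x x' v : E3) :
    ‖(X0 B (t, x, v), V0 B (t, x, v)) - (X0 B (t, x', v), V0 B (t, x', v))‖ ≤ 2 * ‖x - x'‖ := by
  have h0 := flow_z_dep h hδ t x v x' v
  rw [sub_self, norm_zero, mul_zero, add_zero] at h0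
  rw [Prod.mk_sub_mk, Prod.norm_def]
  apply max_le
  · exact ((flowY B (t, x, v) - flowY B (t, x', v)).norm_coe_le_norm 0).trans h0
  · dsimp only
    rw [V0_diff h h, sub_self, zero_sub, norm_neg]
    have h1 := bound_wt (mul_nonneg h.delta_nonneg (norm_nonneg _))
      (lip_path h t (flowY B (t, x, v)) (flowY B (t, x', v)))
    have h6 := h.delta_nonneg
    nlinarith [norm_nonneg (flowY B (t, x, v) - flowY B (t, x', v))]

lemma B_dep (h : GoodField δ B) (h' : GoodField δ B') (hδ : δ ≤ 1 / 8) {d : ℝ} (hd : 0 ≤ d)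
    (hBB : ∀ z, ‖B z - B' z‖ ≤ d) (t : ℝ) (x v : E3) :
    ‖(X0 B (t, x, v), V0 B (t, x, v)) - (X0 B' (t, x, v), V0 B' (t, x, v))‖
      ≤ 2 * (1 + |t|) ^ 2 * d := by
  have hsplit : ∀ η : unitInterval,
      B (t * η, flowY B (t, x, v) η) - B' (t * η, flowY B' (t, x, v) η)
      = (B (t * η, flowY B (t, x, v) η) - B (t * η, flowY B' (t, x, v) η))
        + (B (t * η, flowY B' (t, x, v) η) - B' (t * η, flowY B' (t, x, v) η)) := by
    intro η; abel
  set Y := flowY B (t, x, v) with hY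
  set Y' := flowY B' (t, x, v) with hY'
  have hM : ‖Y - Y'‖ ≤ 2 * (t ^ 2 * d) := by
    apply half_trick
    intro σ
    rw [ContinuousMap.sub_apply, hY, hY', flow_sub h h' hδ, ← hY, ← hY']
    simp only [hsplit, smul_add (kk _ _)]
    rw [integral_add (by
      simp only [smul_sub]
      exact (ui_integrable (h.kpath_cont _ _ _)).sub (ui_integrable (h.kpath_cont _ _ _))) (by
      simp only [smul_sub]
      exact (ui_integrable (h.kpath_cont _ _ _)).sub (ui_integrable (h'.kpath_cont _ _ _)))]
    have h1 := kk_bound_wt (mul_nonneg h.delta_nonneg (norm_nonneg _)) (lip_path h t Y Y') σ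
    have h2 := kk_bound_const (u := fun η : unitInterval => B (t * η, Y' η) - B' (t * η, Y' η))
      (fun η => hBB _) σ
    have h3 : ‖t ^ 2 • ∫ η, kk σ η • (B (t * η, Y' η) - B' (t * η, Y' η))‖ ≤ t ^ 2 * d := by
      rw [norm_smul, Real.norm_of_nonneg (sq_nonneg t)]
      gcongr
    simp only [sub_self, smul_zero, add_zero, zero_add, smul_add]
    refine (norm_add_le _ _).trans ?_
    nlinarith [norm_nonneg (Y - Y')]
  have ht := abs_nonneg t
  have ht2 := sq_abs t
  rw [Prod.mk_sub_mk, Prod.norm_def]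
  apply max_le
  · refine ((Y - Y').norm_coe_le_norm 0).trans (hM.trans ?_)
    have : t ^ 2 * d ≤ (1 + |t|) ^ 2 * d := by
      rw [← ht2]; gcongr; linarith
    linarith
  · dsimp only
    rw [V0_diff h h', sub_self, zero_sub, norm_neg, ← hY, ← hY']
    simp only [hsplit]
    rw [integral_add (by
      exact (ui_integrable (h.path_cont _ _)).sub (ui_integrable (h.path_cont _ _))) (by
      exact (ui_integrable (h.path_cont _ _)).sub (ui_integrable (h'.path_cont _ _)))]
    have h1 := bound_wt (mul_nonneg h.delta_nonneg (norm_nonneg _)) (lip_path h t Y Y')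
    have h2 := bound_const (u := fun η : unitInterval => B (t * η, Y' η) - B' (t * η, Y' η))
      (fun η => hBB _)
    have h3 : ‖t • ∫ η : unitInterval, (B (t * η, Y' η) - B' (t * η, Y' η))‖ ≤ |t| * d := by
      rw [norm_smul, Real.norm_eq_abs]
      gcongr
    rw [smul_add]
    refine (norm_add_le _ _).trans ?_
    have h4 : δ * ‖Y - Y'‖ ≤ 1 / 8 * (2 * (t ^ 2 * d)) := by gcongr
    have h5 : 0 ≤ |t| * d := by positivity
    have h6 : 0 ≤ |t| ^ 2 * d := by positivity
    rw [← ht2] at h4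
    nlinarith

end


/-! ## Part 3: radial integrals and kernel estimates -/

/-- Volume of the unit ball. -/
def cc : ℝ := (volume : Measure E3).real (Metric.ball 0 1)

lemma cc_pos : 0 < cc := by
  unfold cc
  rw [measureReal_def]
  exact ENNReal.toReal_pos (Metric.measure_ball_pos _ _ one_pos).ne' measure_ball_lt_top.ne

lemma vol_ball (x : E3) {L : ℝ} (hL : 0 ≤ L) :
    (volume : Measure E3).real (Metric.ball x L) = L ^ 3 * cc := by
  rw [measureReal_def, Measure.addHaar_ball _ _ hL, ENNReal.toReal_mul,
    ENNReal.toReal_ofReal (by positivity)]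
  simp [cc, measureReal_def]

/-- truncated power -/
def tp (p L : ℝ) (z : E3) : ℝ := (Set.Iio L).indicator (fun r => r ^ (-p)) ‖z‖

lemma tp_nonneg (p L : ℝ) (z : E3) : 0 ≤ tp p L z := by
  unfold tp
  rw [Set.indicator_apply]
  split_ifs
  · exact Real.rpow_nonneg (norm_nonneg _) _
  · exact le_rfl

lemma tp_eq {p L : ℝ} {z : E3} (h : ‖z‖ < L) : tp p L z = ‖z‖ ^ (-p) := by
  unfold tp
  rw [Set.indicator_of_mem]; exact h

lemma tp_radial {p L : ℝ} :
    ∀ y ∈ Set.Ioi (0 : ℝ), y ^ (Module.finrank ℝ E3 - 1) •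
      (Set.Iio L).indicator (fun r => r ^ (-p)) y
      = (Set.Iio L).indicator (fun y => y ^ (2 - p)) y := by
  intro y hy
  simp only [finrank_euclideanSpace, Fintype.card_fin, Set.indicator_apply, smul_eq_mul]
  split_ifs
  · rw [sub_eq_add_neg, Real.rpow_add hy]
    norm_num
  · simp

lemma tp_integrable {p : ℝ} (hp : p < 3) {L : ℝ} (hL : 0 < L) : Integrable (tp p L) := by
  unfold tp
  rw [integrable_fun_norm_addHaar (volume : Measure E3)
    (f := (Set.Iio L).indicator (fun r => r ^ (-p)))]
  rw [integrableOn_congr_fun tp_radial measurableSet_Ioi]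
  rw [integrableOn_indicator_iff measurableSet_Iio]
  have h1 := intervalIntegral.intervalIntegrable_rpow' (a := 0) (b := L)
    (r := 2 - p) (by linarith)
  rw [intervalIntegrable_iff_integrableOn_Ioo_of_le hL.le] at h1
  rwa [Set.Ioi_inter_Iio.symm, Set.inter_comm] at h1

lemma tp_integral {p : ℝ} (hp : p < 3) {L : ℝ} (hL : 0 < L) :
    ∫ z, tp p L z = 3 * cc * (L ^ (3 - p) / (3 - p)) := by
  unfold tp
  rw [integral_fun_norm_addHaar (volume : Measure E3)
    (f := (Set.Iio L).indicator (fun r => r ^ (-p)))]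
  rw [setIntegral_congr_fun measurableSet_Ioi tp_radial]
  rw [setIntegral_indicator measurableSet_Iio, Set.Ioi_inter_Iio,
    ← integral_Ioc_eq_integral_Ioo, ← intervalIntegral.integral_of_le hL.le,
    integral_rpow (Or.inl (by linarith))]
  have e : 2 - p + 1 = 3 - p := by ring
  rw [e, Real.zero_rpow (by linarith)]
  simp [cc]
  ring

/-- constant in the ball estimate -/
def Cp (p : ℝ) : ℝ := 3 * cc / (3 - p) + cc

lemma Cp_pos {p : ℝ} (hp : p < 3) : 0 < Cp p := by
  have := cc_pos
  have : 0 < 3 - p := by linarith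
  unfold Cp; positivity

lemma rpow_le_tp {p L : ℝ} (hp : 0 ≤ p) (hL : 0 < L) (z : E3) :
    ‖z‖ ^ (-p) ≤ tp p L z + L ^ (-p) := by
  have h2 : 0 ≤ L ^ (-p) := Real.rpow_nonneg hL.le _
  by_cases h : ‖z‖ < L
  · rw [tp_eq h]; linarith
  · have h1 := tp_nonneg p L z
    push Not at h
    have : ‖z‖ ^ (-p) ≤ L ^ (-p) := Real.rpow_le_rpow_of_nonpos hL h (by linarith)
    linarith

lemma ballW_integrable {p L : ℝ} (hp3 : p < 3) (hL : 0 < L) (x : E3) :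
    Integrable ((Metric.ball (0 : E3) L).indicator
      (fun y => tp p L (x - y) + L ^ (-p))) := by
  rw [integrable_indicator_iff measurableSet_ball]
  apply Integrable.add
  · exact ((tp_integrable hp3 hL).comp_sub_left x).integrableOn
  · exact integrableOn_const measure_ball_lt_top.ne

lemma ballW_integral {p L : ℝ} (hp3 : p < 3) (hL : 0 < L) (x : E3) :
    ∫ y, (Metric.ball (0 : E3) L).indicator
      (fun y => tp p L (x - y) + L ^ (-p)) y ≤ Cp p * L ^ (3 - p) := by
  have hI := (tp_integrable hp3 hL).comp_sub_left x
  rw [integral_indicator measurableSet_ball, integral_add hI.integrableOn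
    (integrableOn_const measure_ball_lt_top.ne), setIntegral_const, vol_ball _ hL.le]
  have h1 : ∫ y in Metric.ball (0 : E3) L, tp p L (x - y) ≤ ∫ y, tp p L (x - y) :=
    setIntegral_le_integral hI (Eventually.of_forall fun y => tp_nonneg _ _ _)
  rw [integral_sub_left_eq_self (fun z => tp p L z) volume x, tp_integral hp3 hL] at h1
  have h2 : (L ^ 3 * cc) • L ^ (-p) = cc * L ^ (3 - p) := by
    rw [sub_eq_add_neg, Real.rpow_add hL, smul_eq_mul]
    norm_num
    ring
  rw [h2, Cp]
  have : 0 < 3 - p := by linarith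
  have e : (3 * cc / (3 - p) + cc) * L ^ (3 - p)
      = 3 * cc * (L ^ (3 - p) / (3 - p)) + cc * L ^ (3 - p) := by ring
  rw [e]
  linarith

/-- Bound of a convolution with a kernel dominated by a power. -/
lemma conv_bound {p L A c : ℝ} (hp : 0 ≤ p) (hL : 0 < L) (hA : 0 ≤ A)
    (hc : 0 ≤ c)
    {g : E3 → ℝ} (hg : ∀ y, |g y| ≤ A) (hgs : ∀ y, g y ≠ 0 → ‖y‖ < L)
    (x : E3) :
    ∀ y, ∀ b : E3, ‖b‖ ≤ c * ‖x - y‖ ^ (-p) → ‖g y • b‖ ≤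
      (A * c) * (Metric.ball (0 : E3) L).indicator (fun y => tp p L (x - y) + L ^ (-p)) y := by
  intro y b hb
  by_cases hy : g y = 0
  · rw [hy, zero_smul, norm_zero]
    apply mul_nonneg (by positivity)
    apply Set.indicator_nonneg
    intro z _
    have := tp_nonneg p L (x - z)
    positivity
  · rw [Set.indicator_of_mem (by simpa using hgs y hy), norm_smul, Real.norm_eq_abs, mul_assoc]
    have := rpow_le_tp hp hL (x - y)
    have h3 := hg y
    gcongr
    exact hb.trans (by gcongr)

lemma conv_norm_le {p L A c : ℝ} (hp : 0 ≤ p) (hp3 : p < 3) (hL : 0 < L) (hA : 0 ≤ A)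
    (hc : 0 ≤ c)
    {g : E3 → ℝ} (hg : ∀ y, |g y| ≤ A) (hgs : ∀ y, g y ≠ 0 → ‖y‖ < L)
    (x : E3) (k : E3 → E3) (hk : ∀ᵐ y, ‖k y‖ ≤ c * ‖x - y‖ ^ (-p)) :
    ‖∫ y, g y • k y‖ ≤ A * c * (Cp p * L ^ (3 - p)) := by
  refine (norm_integral_le_of_norm_le ((ballW_integrable hp3 hL x).const_mul (A * c)) ?_).trans ?_
  · filter_upwards [hk] with y hy
    exact conv_bound hp hL hA hc hg hgs x y _ hy
  · rw [integral_const_mul]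
    gcongr
    exact ballW_integral hp3 hL x

lemma conv_integrable {p L A c : ℝ} (hp : 0 ≤ p) (hp3 : p < 3) (hL : 0 < L) (hA : 0 ≤ A)
    (hc : 0 ≤ c)
    {g : E3 → ℝ} (hgm : AEStronglyMeasurable g) (hg : ∀ y, |g y| ≤ A)
    (hgs : ∀ y, g y ≠ 0 → ‖y‖ < L)
    (x : E3) {k : E3 → E3} (hkm : AEStronglyMeasurable k)
    (hk : ∀ᵐ y, ‖k y‖ ≤ c * ‖x - y‖ ^ (-p)) :
    Integrable (fun y => g y • k y) := by
  refine Integrable.mono' ((ballW_integrable hp3 hL x).const_mul (A * c)) (hgm.smul hkm) ?_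
  filter_upwards [hk] with y hy
  exact conv_bound hp hL hA hc hg hgs x y _ hy

/-- The Coulomb kernel (without constant). -/
def KK (a : E3) : E3 := (‖a‖ ^ 3)⁻¹ • a

/-- Kernel flattened near the origin. -/
def GG (a : E3) : E3 := ((max 1 ‖a‖) ^ 3)⁻¹ • a

lemma KK_norm (a : E3) : ‖KK a‖ = ‖a‖ ^ (-2 : ℝ) := by
  by_cases h : a = 0
  · simp [h, KK]
  · have : 0 < ‖a‖ := norm_pos_iff.2 h
    rw [KK, norm_smul, norm_inv, norm_pow, norm_norm, Real.rpow_neg this.le]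
    norm_num
    field_simp

lemma KK_meas : Measurable KK := by
  unfold KK; fun_prop

lemma GG_meas : Measurable GG := by
  unfold GG; fun_prop

lemma GG_norm (a : E3) : ‖GG a‖ ≤ ‖KK a‖ := by
  by_cases h : a = 0
  · simp [h, KK, GG]
  · have : 0 < ‖a‖ := norm_pos_iff.2 h
    rw [KK, GG, norm_smul, norm_smul]
    gcongr
    rw [norm_inv, norm_inv, norm_pow, norm_pow, norm_norm]
    apply inv_anti₀ (by positivity)
    gcongr
    rw [Real.norm_eq_abs]
    exact (le_max_right _ _).trans (le_abs_self _)

lemma KG_norm (a : E3) : ‖KK a - GG a‖ ≤ tp 2 1 a := by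
  by_cases h1 : ‖a‖ < 1
  · rw [tp_eq h1, ← KK_norm]
    have e : KK a - GG a = (1 - ‖a‖ ^ 3) • KK a := by
      rw [sub_smul, one_smul]
      congr 1
      rw [GG, KK, max_eq_left h1.le]
      by_cases h : a = 0
      · simp [h]
      · have : 0 < ‖a‖ := norm_pos_iff.2 h
        rw [smul_smul]
        congr 1
        field_simp
    rw [e, norm_smul]
    have h3 : ‖a‖ ^ 3 ≤ 1 := pow_le_one₀ (norm_nonneg _) h1.le
    have h4 : 0 ≤ ‖a‖ ^ 3 := by positivity
    apply mul_le_of_le_one_left (norm_nonneg _)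
    rw [Real.norm_eq_abs, abs_le]; constructor <;> linarith
  · push Not at h1
    rw [GG, KK, max_eq_right h1, sub_self, norm_zero]
    exact tp_nonneg _ _ _

lemma GG_lip_aux {m n s : ℝ} (hm : 1 ≤ m) (hn : 1 ≤ n) (hs : |m - n| ≤ s) :
    (m ^ 3)⁻¹ * s + |(m ^ 3)⁻¹ - (n ^ 3)⁻¹| * n ≤ 3 * s * ((m ^ 3)⁻¹ + (n ^ 3)⁻¹) := by
  obtain ⟨p, hp⟩ : ∃ p, p = m⁻¹ := ⟨_, rfl⟩
  obtain ⟨q, hq⟩ : ∃ q, q = n⁻¹ := ⟨_, rfl⟩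
  have hp0 : 0 < p := by rw [hp]; positivity
  have hq0 : 0 < q := by rw [hq]; positivity
  rw [← inv_pow, ← inv_pow, ← hp, ← hq]
  have e : |p ^ 3 - q ^ 3| * n = |m - n| * (p * (p ^ 2 + p * q + q ^ 2)) := by
    have e1 : p ^ 3 - q ^ 3 = (n - m) * (p * q * (p ^ 2 + p * q + q ^ 2)) := by
      rw [hp, hq]; field_simp; ring
    rw [e1, abs_mul, abs_sub_comm, abs_of_pos (a := p * q * _) (by positivity)]
    have : q * n = 1 := by rw [hq]; field_simp
    linear_combination (|m - n| * p * (p ^ 2 + p * q + q ^ 2)) * this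
  rw [e]
  have hs0 : 0 ≤ s := (abs_nonneg _).trans hs
  have h1 : |m - n| * (p * (p ^ 2 + p * q + q ^ 2)) ≤ s * (p * (p ^ 2 + p * q + q ^ 2)) := by
    gcongr
  have h2 : p ^ 2 * q + p * q ^ 2 ≤ p ^ 3 + q ^ 3 := by
    nlinarith [mul_nonneg (add_pos hp0 hq0).le (sq_nonneg (p - q))]
  have h3 : p ^ 3 + p * (p ^ 2 + p * q + q ^ 2) ≤ 3 * (p ^ 3 + q ^ 3) := by
    have : 0 < q ^ 3 := by positivity
    nlinarith
  nlinarith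

lemma inv_max_le {a : E3} (ha : a ≠ 0) : ((max 1 ‖a‖) ^ 3)⁻¹ ≤ ‖a‖ ^ (-(5 / 2) : ℝ) := by
  have h0 : 0 < ‖a‖ := norm_pos_iff.2 ha
  set m := max 1 ‖a‖ with hm
  have h1 : 1 ≤ m := le_max_left _ _
  calc (m ^ 3)⁻¹ = m ^ (-3 : ℝ) := by
        rw [Real.rpow_neg (by linarith)]; norm_num
    _ ≤ m ^ (-(5 / 2) : ℝ) := Real.rpow_le_rpow_of_exponent_le h1 (by norm_num)
    _ ≤ _ := Real.rpow_le_rpow_of_nonpos h0 (le_max_right _ _) (by norm_num)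

lemma GG_lip {a b : E3} (ha : a ≠ 0) (hb : b ≠ 0) :
    ‖GG a - GG b‖ ≤ 3 * ‖a - b‖ * ‖a‖ ^ (-(5 / 2) : ℝ)
      + 3 * ‖a - b‖ * ‖b‖ ^ (-(5 / 2) : ℝ) := by
  set m := max 1 ‖a‖ with hm
  set n := max 1 ‖b‖ with hn
  have e : GG a - GG b = (m ^ 3)⁻¹ • (a - b) + ((m ^ 3)⁻¹ - (n ^ 3)⁻¹) • b := by
    simp only [GG, ← hm, ← hn, smul_sub, sub_smul]; abel
  have hmn : |m - n| ≤ ‖a - b‖ := by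
    have h1 := abs_max_sub_max_le_abs ‖a‖ ‖b‖ 1
    rw [max_comm ‖a‖, max_comm ‖b‖] at h1
    exact h1.trans (abs_norm_sub_norm_le a b)
  have h1 := GG_lip_aux (le_max_left 1 ‖a‖) (le_max_left 1 ‖b‖) hmn
  have h2 := inv_max_le ha
  have h3 := inv_max_le hb
  rw [← hm] at h1 h2
  rw [← hn] at h1 h3
  have hm0 : 0 < m := lt_of_lt_of_le one_pos (le_max_left 1 ‖a‖)
  calc ‖GG a - GG b‖ ≤ (m ^ 3)⁻¹ * ‖a - b‖ + |(m ^ 3)⁻¹ - (n ^ 3)⁻¹| * ‖b‖ := by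
        rw [e]
        refine (norm_add_le _ _).trans ?_
        rw [norm_smul, norm_smul, Real.norm_of_nonneg (by positivity), Real.norm_eq_abs]
    _ ≤ (m ^ 3)⁻¹ * ‖a - b‖ + |(m ^ 3)⁻¹ - (n ^ 3)⁻¹| * n := by
        gcongr; exact le_max_right _ _
    _ ≤ 3 * ‖a - b‖ * ((m ^ 3)⁻¹ + (n ^ 3)⁻¹) := h1
    _ ≤ 3 * ‖a - b‖ * (‖a‖ ^ (-(5 / 2) : ℝ) + ‖b‖ ^ (-(5 / 2) : ℝ)) := by gcongr
    _ = _ := by ring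

/-- Convolution of a Lipschitz function with a short range kernel is Lipschitz. -/
lemma conv_short_lip {k : E3 → E3} (hkm : AEStronglyMeasurable k) {r : ℝ} (hr : 0 < r)
    (hk : ∀ a, ‖k a‖ ≤ tp 2 r a) {g : E3 → ℝ} (hgc : Continuous g) {A Λ : ℝ}
    (hA : ∀ y, |g y| ≤ A) (hΛ : ∀ y y', |g y - g y'| ≤ Λ * ‖y - y'‖) (x x' : E3) :
    ‖(∫ y, g y • k (x - y)) - ∫ y, g y • k (x' - y)‖ ≤ Λ * ‖x - x'‖ * (3 * cc * r) := by
  have hki : Integrable k := (tp_integrable (by norm_num) hr).mono' hkm (Eventually.of_forall hk)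
  have e : ∀ x, ∫ y, g y • k (x - y) = ∫ z, g (x - z) • k z := by
    intro x
    rw [← integral_sub_left_eq_self (fun z => g (x - z) • k z) volume x]
    simp
  have hi : ∀ x : E3, Integrable (fun z => g (x - z) • k z) := by
    intro x
    refine Integrable.bdd_smul (φ := fun z => g (x - z)) hki A ?_ ?_
    · exact (hgc.comp (by fun_prop)).aestronglyMeasurable
    · exact Eventually.of_forall fun z => by rw [Real.norm_eq_abs]; exact hA _
  rw [e, e, ← integral_sub (hi x) (hi x')]
  have h1 : ∀ z, ‖g (x - z) • k z - g (x' - z) • k z‖ ≤ Λ * ‖x - x'‖ * tp 2 r z := by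
    intro z
    rw [← sub_smul, norm_smul, Real.norm_eq_abs]
    have h2 := hΛ (x - z) (x' - z)
    rw [sub_sub_sub_cancel_right] at h2
    have h3 := hk z
    have := (abs_nonneg _).trans h2
    gcongr
  refine (norm_integral_le_of_norm_le
    ((tp_integrable (by norm_num) hr).const_mul _) (Eventually.of_forall h1)).trans ?_
  rw [integral_const_mul, tp_integral (by norm_num) hr]
  apply le_of_eq
  norm_num

/-- Field (without constant) of a density. -/
def fld (g : E3 → ℝ) (x : E3) : E3 := ∫ y, g y • KK (x - y)

lemma ae_sub_ne (x : E3) : ∀ᵐ y : E3, x - y ≠ 0 := by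
  have : ∀ᵐ y : E3, y ≠ x := by
    rw [ae_iff]; simp
  filter_upwards [this] with y hy
  exact sub_ne_zero.2 (Ne.symm hy)

lemma fld_bound {g : E3 → ℝ} {A L : ℝ} (hL : 0 < L) (hg : ∀ y, |g y| ≤ A)
    (hgs : ∀ y, g y ≠ 0 → ‖y‖ < L) (x : E3) :
    ‖fld g x‖ ≤ A * (Cp 2 * L) := by
  have := conv_norm_le (p := 2) (c := 1) (by norm_num) (by norm_num) hL
    ((abs_nonneg _).trans (hg 0)) zero_le_one hg hgs x (fun y => KK (x - y))
    (Eventually.of_forall fun y => by rw [KK_norm, one_mul])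
  norm_num at this
  exact this

lemma fld_integrable {g : E3 → ℝ} (hgc : AEStronglyMeasurable g) {A L : ℝ} (hL : 0 < L)
    (hg : ∀ y, |g y| ≤ A)
    (hgs : ∀ y, g y ≠ 0 → ‖y‖ < L) (x : E3) : Integrable (fun y => g y • KK (x - y)) :=
  conv_integrable (p := 2) (c := 1) (by norm_num) (by norm_num) hL
    ((abs_nonneg _).trans (hg 0)) zero_le_one hgc hg hgs x
    (KK_meas.comp (by fun_prop)).aestronglyMeasurable
    (Eventually.of_forall fun y => by rw [KK_norm, one_mul])

lemma GG_integrable {g : E3 → ℝ} (hgc : AEStronglyMeasurable g) {A L : ℝ} (hL : 0 < L)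
    (hg : ∀ y, |g y| ≤ A)
    (hgs : ∀ y, g y ≠ 0 → ‖y‖ < L) (x : E3) : Integrable (fun y => g y • GG (x - y)) :=
  conv_integrable (p := 2) (c := 1) (by norm_num) (by norm_num) hL
    ((abs_nonneg _).trans (hg 0)) zero_le_one hgc hg hgs x
    (GG_meas.comp (by fun_prop)).aestronglyMeasurable
    (Eventually.of_forall fun y => by rw [one_mul, ← KK_norm]; exact GG_norm _)

lemma fld_lip {g : E3 → ℝ} (hgc : Continuous g) {A L Λ : ℝ} (hL : 0 < L)
    (hg : ∀ y, |g y| ≤ A) (hgs : ∀ y, g y ≠ 0 → ‖y‖ < L)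
    (hΛ : ∀ y y', |g y - g y'| ≤ Λ * ‖y - y'‖) (x x' : E3) :
    ‖fld g x - fld g x'‖ ≤ (3 * cc * Λ + 6 * A * Cp (5 / 2) * √L) * ‖x - x'‖ := by
  have hgm := hgc.aestronglyMeasurable (μ := (volume : Measure E3))
  have hA : 0 ≤ A := (abs_nonneg _).trans (hg 0)
  have hKi := fld_integrable hgm hL hg hgs
  have hGi := GG_integrable hgm hL hg hgs
  have h1 := conv_short_lip (k := fun a => KK a - GG a)
    (KK_meas.sub GG_meas).aestronglyMeasurable one_pos KG_norm hgc hg hΛ x x'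
  have e1 : ∀ x, ∫ y, g y • (KK (x - y) - GG (x - y))
      = fld g x - ∫ y, g y • GG (x - y) := by
    intro x
    simp only [smul_sub]
    rw [integral_sub (hKi x) (hGi x)]; rfl
  rw [e1, e1] at h1
  -- far part
  have hfar : ‖(∫ y, g y • GG (x - y)) - ∫ y, g y • GG (x' - y)‖
      ≤ 6 * A * Cp (5 / 2) * √L * ‖x - x'‖ := by
    rw [← integral_sub (hGi x) (hGi x')]
    simp only [← smul_sub]
    have hp : (0 : ℝ) ≤ 5 / 2 := by norm_num
    have hp3 : (5 / 2 : ℝ) < 3 := by norm_num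
    have hc : 0 ≤ 3 * ‖x - x'‖ := by positivity
    have hb := fun w => (ballW_integrable hp3 hL w).const_mul (A * (3 * ‖x - x'‖))
    refine (norm_integral_le_of_norm_le ((hb x).add (hb x')) ?_).trans ?_
    · filter_upwards [ae_sub_ne x, ae_sub_ne x'] with y hy hy'
      have h2 := GG_lip hy hy'
      rw [sub_sub_sub_cancel_right] at h2
      have h3 := conv_bound hp hL hA hc hg hgs x y
        ((3 * ‖x - x'‖ * ‖x - y‖ ^ (-(5 / 2) : ℝ)) • (EuclideanSpace.single 0 1 : E3)) (by
          rw [norm_smul]; simp [Real.norm_eq_abs, abs_of_nonneg, Real.rpow_nonneg])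
      have h4 := conv_bound hp hL hA hc hg hgs x' y
        ((3 * ‖x - x'‖ * ‖x' - y‖ ^ (-(5 / 2) : ℝ)) • (EuclideanSpace.single 0 1 : E3)) (by
          rw [norm_smul]; simp [Real.norm_eq_abs, abs_of_nonneg, Real.rpow_nonneg])
      have n1 : ∀ c : ℝ, 0 ≤ c → ‖c • (EuclideanSpace.single 0 1 : E3)‖ = c := by
        intro c hc
        rw [norm_smul]; simp [abs_of_nonneg hc]
      rw [norm_smul, n1 _ (by positivity)] at h3 h4
      rw [norm_smul]
      simp only [Pi.add_apply]
      have h5 := mul_le_mul_of_nonneg_left h2 (norm_nonneg (g y))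
      linarith
    · rw [integral_add' (hb x) (hb x')]
      rw [integral_const_mul, integral_const_mul]
      have h5 := ballW_integral hp3 hL x
      have h6 := ballW_integral hp3 hL x'
      have e5 : L ^ (3 - 5 / 2 : ℝ) = √L := by
        rw [Real.sqrt_eq_rpow]; norm_num
      rw [e5] at h5 h6
      have h7 := mul_le_mul_of_nonneg_left h5 (mul_nonneg hA hc)
      have h8 := mul_le_mul_of_nonneg_left h6 (mul_nonneg hA hc)
      linarith
  have := norm_add_le (fld g x - (∫ y, g y • GG (x - y)) - (fld g x' - ∫ y, g y • GG (x' - y)))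
    ((∫ y, g y • GG (x - y)) - ∫ y, g y • GG (x' - y))
  have e2 : fld g x - (∫ y, g y • GG (x - y)) - (fld g x' - ∫ y, g y • GG (x' - y))
    + ((∫ y, g y • GG (x - y)) - ∫ y, g y • GG (x' - y)) = fld g x - fld g x' := by abel
  rw [e2] at this
  linarith

lemma fld_sub_le {g g' : E3 → ℝ} (hgc : Continuous g) (hgc' : Continuous g') {A L : ℝ}
    (hL : 0 < L)
    (hg : ∀ y, |g y - g' y| ≤ A) {A' : ℝ} (hgA : ∀ y, |g y| ≤ A') (hgA' : ∀ y, |g' y| ≤ A')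
    (hgs : ∀ y, g y ≠ 0 → ‖y‖ < L) (hgs' : ∀ y, g' y ≠ 0 → ‖y‖ < L) (x : E3) :
    ‖fld g x - fld g' x‖ ≤ A * (Cp 2 * L) := by
  have h := fld_bound (g := fun y => g y - g' y) hL hg (by
    intro y hy
    by_cases h1 : g y = 0
    · apply hgs'
      intro h2; apply hy; rw [h1, h2, sub_self]
    · exact hgs y h1) x
  have e : fld (fun y => g y - g' y) x = fld g x - fld g' x := by
    unfold fld
    rw [← integral_sub (fld_integrable hgc.aestronglyMeasurable hL hgA hgs x)
      (fld_integrable hgc'.aestronglyMeasurable hL hgA' hgs' x)]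
    simp only [sub_smul]
  rwa [e] at h


/-! ## Part 4: densities, fields and the fixed point -/

/-- Time weight `(1+|t|)^{-3}`. -/
def w3 (t : ℝ) : ℝ := ((1 + |t|) ^ 3)⁻¹

lemma w3_pos (t : ℝ) : 0 < w3 t := by unfold w3; positivity

lemma w3_le_one (t : ℝ) : w3 t ≤ 1 := by
  unfold w3
  apply inv_le_one_of_one_le₀
  exact one_le_pow₀ (by linarith [abs_nonneg t])

/-- Densities with free-streaming decay. -/
structure GoodDens (A R : ℝ) (ρ : ℝ → E3 → ℝ) : Prop where
  cont : Continuous (fun q : ℝ × E3 => ρ q.1 q.2)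
  bd : ∀ t x, |ρ t x| ≤ A * w3 t
  lip : ∀ t x y, |ρ t x - ρ t y| ≤ 2 * A * w3 t * ‖x - y‖
  supp : ∀ t x, ρ t x ≠ 0 → ‖x‖ < (R + 3) * (1 + |t|)

lemma exists_ball {g : E3 → ℝ} {q : ℝ}
    (h1 : ∀ v v', g v ≠ 0 → g v' ≠ 0 → ‖v - v'‖ < q) :
    ∃ c : E3, ∀ v, g v ≠ 0 → v ∈ Metric.ball c q := by
  by_cases h : ∃ c, g c ≠ 0
  · obtain ⟨c, hc⟩ := h
    exact ⟨c, fun v hv => by rw [mem_ball_iff_norm]; exact h1 v c hv hc⟩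
  · push Not at h
    exact ⟨0, fun v hv => absurd (h v) hv⟩

lemma int_diff_le {g g' : E3 → ℝ} (hg : Continuous g) (hg' : Continuous g') {q m : ℝ} (hq : 0 ≤ q)
    (h1 : ∀ v v', g v ≠ 0 → g v' ≠ 0 → ‖v - v'‖ < q)
    (h1' : ∀ v v', g' v ≠ 0 → g' v' ≠ 0 → ‖v - v'‖ < q)
    (hm : ∀ v, |g v - g' v| ≤ m) :
    |(∫ v, g v) - ∫ v, g' v| ≤ m * (2 * (q ^ 3 * cc)) := by
  obtain ⟨c, hc⟩ := exists_ball h1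
  obtain ⟨c', hc'⟩ := exists_ball h1'
  have hm0 : 0 ≤ m := (abs_nonneg _).trans (hm 0)
  have hi : ∀ {g : E3 → ℝ} {c : E3}, Continuous g → (∀ v, g v ≠ 0 → v ∈ Metric.ball c q) →
      Integrable g := by
    intro g c hg hc
    apply hg.integrable_of_hasCompactSupport
    apply HasCompactSupport.intro (isCompact_closedBall c q)
    intro v hv
    by_contra h
    exact hv (Metric.ball_subset_closedBall (hc v h))
  have hind : ∀ c : E3, Integrable ((Metric.ball c q).indicator (fun _ => m)) := fun c => by
    rw [integrable_indicator_iff measurableSet_ball]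
    exact integrableOn_const measure_ball_lt_top.ne
  have hintg : ∀ c : E3, ∫ v, (Metric.ball c q).indicator (fun _ => m) v = q ^ 3 * cc * m := by
    intro c
    rw [integral_indicator measurableSet_ball, setIntegral_const, vol_ball _ hq, smul_eq_mul]
  rw [← integral_sub (hi hg hc) (hi hg' hc'), ← Real.norm_eq_abs]
  refine (norm_integral_le_of_norm_le ((hind c).add (hind c')) (Eventually.of_forall ?_)).trans ?_
  · intro v
    rw [Real.norm_eq_abs, Pi.add_apply]
    have p1 : ∀ c : E3, 0 ≤ (Metric.ball c q).indicator (fun _ => m) v := fun c =>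
      Set.indicator_nonneg (fun _ _ => hm0) v
    by_cases h : g v = 0
    · by_cases h' : g' v = 0
      · rw [h, h', sub_zero, abs_zero]; exact add_nonneg (p1 c) (p1 c')
      · rw [Set.indicator_of_mem (hc' v h')]
        have := p1 c
        have := hm v
        linarith
    · rw [Set.indicator_of_mem (hc v h)]
      have := p1 c'
      have := hm v
      linarith
  · rw [integral_add' (hind c) (hind c'), hintg, hintg]
    apply le_of_eq; ring

/-- Constant in the density estimates. -/
def kap (R : ℝ) : ℝ := 2 * cc * (6 * R + 3) ^ 3

lemma kap_pos {R : ℝ} (hR : 0 < R) : 0 < kap R := by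
  have := cc_pos
  unfold kap; positivity

/-- Admissible data. -/
structure GoodData (ε R : ℝ) (f₀ : E3 × E3 → ℝ) : Prop where
  cont : Continuous f₀
  nonneg : ∀ z, 0 ≤ f₀ z
  supp : ∀ x v : E3, f₀ (x, v) ≠ 0 → ‖x‖ ≤ R ∧ ‖v‖ ≤ R
  bd : ∀ z, |f₀ z| ≤ ε
  lip : ∀ z z', |f₀ z - f₀ z'| ≤ ε * ‖z - z'‖

section
variable {δ ε R : ℝ} {B B' : ℝ × E3 → E3} {f₀ : E3 × E3 → ℝ}

lemma v_supp' (h : GoodField δ B) (hδ : δ ≤ 1 / 8) (hR : 0 < R) (hf : GoodData ε R f₀)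
    (t : ℝ) (x v v' : E3)
    (hF : FF f₀ B (t, x, v) ≠ 0) (hF' : FF f₀ B (t, x, v') ≠ 0) :
    ‖v - v'‖ < (6 * R + 3) / (1 + |t|) := by
  refine (v_supp h hδ hf.supp hF hF').trans_lt ?_
  gcongr
  norm_num

lemma w3_kap (t m : ℝ) : m * (2 * (((6 * R + 3) / (1 + |t|)) ^ 3 * cc)) = m * kap R * w3 t := by
  unfold kap w3
  rw [div_pow]
  field_simp

lemma FF_cont_v (h : GoodField δ B) (hδ : δ ≤ 1 / 8) (hf : GoodData ε R f₀) (t : ℝ) (x : E3) :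
    Continuous (fun v => FF f₀ B (t, x, v)) :=
  (FF_cont h hδ hf.cont).comp (by fun_prop)

lemma dens_cont (h : GoodField δ B) (hδ : δ ≤ 1 / 8) (hf : GoodData ε R f₀) :
    Continuous (fun q : ℝ × E3 => vpDensity (FF f₀ B) q.1 q.2) := by
  have e : (fun q : ℝ × E3 => vpDensity (FF f₀ B) q.1 q.2) = fun q : ℝ × E3 =>
      ∫ v in Metric.closedBall (0 : E3) (R + 1), FF f₀ B (q.1, q.2, v) := by
    funext q
    unfold vpDensity
    rw [setIntegral_eq_integral_of_forall_compl_eq_zero]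
    intro v hv
    by_contra hc
    apply hv
    rw [mem_closedBall_zero_iff]
    exact (supp_bound h hδ hf.supp hc).1
  rw [e]
  apply continuous_parametric_integral_of_continuous (f := fun (q : ℝ × E3) v => FF f₀ B (q.1, q.2, v))
    _ (isCompact_closedBall _ _)
  exact (FF_cont h hδ hf.cont).comp (by fun_prop)

lemma goodDens (h : GoodField δ B) (hδ : δ ≤ 1 / 8) (hR : 0 < R) (hf : GoodData ε R f₀) :
    GoodDens (ε * kap R) R (vpDensity (FF f₀ B)) where
  cont := dens_cont h hδ hf
  bd := by
    intro t x
    have := int_diff_le (m := ε) (FF_cont_v h hδ hf t x) (continuous_const (y := (0 : ℝ))) 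
      (q := (6 * R + 3) / (1 + |t|)) (by positivity) (v_supp' h hδ hR hf t x) (by simp)
      (by intro v; rw [sub_zero]; exact hf.bd _)
    rw [w3_kap] at this
    simpa [vpDensity] using this
  lip := by
    intro t x y
    have := int_diff_le (m := ε * (2 * ‖x - y‖)) (FF_cont_v h hδ hf t x) (FF_cont_v h hδ hf t y)
      (q := (6 * R + 3) / (1 + |t|)) (by positivity) (v_supp' h hδ hR hf t x)
      (v_supp' h hδ hR hf t y)
      (by
        intro v
        refine (hf.lip _ _).trans ?_
        have h1 := x_dep h hδ t x y v
        have : 0 ≤ ε := (abs_nonneg _).trans (hf.bd 0)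
        gcongr)
    rw [w3_kap] at this
    refine this.trans (le_of_eq ?_)
    ring
  supp := by
    intro t x hx
    by_contra hc
    apply hx
    unfold vpDensity
    rw [integral_eq_zero_of_ae]
    refine Eventually.of_forall fun v => ?_
    by_contra hv
    have := (supp_bound h hδ hf.supp hv).2
    apply hc
    have h2 := abs_nonneg t
    nlinarith

lemma dens_diff (h : GoodField δ B) (h' : GoodField δ B') (hδ : δ ≤ 1 / 8) (hR : 0 < R)
    (hf : GoodData ε R f₀) {d : ℝ} (hd : 0 ≤ d)
    (hBB : ∀ z, ‖B z - B' z‖ ≤ d) (t : ℝ) (x : E3) :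
    |vpDensity (FF f₀ B) t x - vpDensity (FF f₀ B') t x| ≤ 2 * (ε * kap R) * d * (1 + |t|)⁻¹ := by
  have := int_diff_le (m := ε * (2 * (1 + |t|) ^ 2 * d)) (FF_cont_v h hδ hf t x)
      (FF_cont_v h' hδ hf t x)
      (q := (6 * R + 3) / (1 + |t|)) (by positivity) (v_supp' h hδ hR hf t x)
      (v_supp' h' hδ hR hf t x)
      (by
        intro v
        refine (hf.lip _ _).trans ?_
        have h1 := B_dep h h' hδ hd hBB t x v
        have : 0 ≤ ε := (abs_nonneg _).trans (hf.bd 0)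
        gcongr)
  rw [w3_kap] at this
  refine this.trans (le_of_eq ?_)
  unfold w3
  have : 0 < 1 + |t| := by positivity
  field_simp

lemma vpField_eq (F : ℝ × E3 × E3 → ℝ) (t : ℝ) (x : E3) :
    vpField F t x = (4 * π)⁻¹ • fld (vpDensity F t) x := by
  unfold vpField fld KK
  congr 2
  funext y
  rw [smul_smul, div_eq_mul_inv]

end

lemma GoodDens.A_nonneg {A R : ℝ} {ρ : ℝ → E3 → ℝ} (h : GoodDens A R ρ) : 0 ≤ A := by
  have h1 := (abs_nonneg _).trans (h.bd 0 0)
  have h2 := w3_pos 0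
  by_contra hc
  push Not at hc
  nlinarith

lemma GoodDens.cont_x {A R : ℝ} {ρ : ℝ → E3 → ℝ} (h : GoodDens A R ρ) (t : ℝ) :
    Continuous (ρ t) := h.cont.comp (by fun_prop : Continuous (fun x : E3 => (t, x)))

/-- joint continuity of convolutions with a singular kernel -/
lemma conv_joint_cont {A R : ℝ} {ρ : ℝ → E3 → ℝ} (h : GoodDens A R ρ) (hR : 0 < R)
    {V : Type*} [NormedAddCommGroup V] [NormedSpace ℝ V]
    {k : E3 → V} (hk : AEStronglyMeasurable k) {c : ℝ} (hkb : ∀ a, ‖k a‖ ≤ c * ‖a‖ ^ (-2 : ℝ)) :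
    Continuous (fun q : ℝ × E3 => ∫ y, ρ q.1 y • k (q.2 - y)) := by
  have e : ∀ q : ℝ × E3, ∫ y, ρ q.1 y • k (q.2 - y) = ∫ z, ρ q.1 (q.2 - z) • k z := by
    intro q
    rw [← integral_sub_left_eq_self (fun z => ρ q.1 (q.2 - z) • k z) volume q.2]
    simp
  simp only [e]
  have hA := h.A_nonneg
  rw [continuous_iff_continuousAt]
  intro q₀
  set T : ℝ := |q₀.1| + 1
  set r : ℝ := ‖q₀.2‖ + 1 + (R + 3) * (1 + T)
  have hr : 0 < r := by positivity
  apply continuousAt_of_dominated (bound := fun z => A * (|c| * tp 2 r z))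
  · refine Eventually.of_forall fun q => ?_
    exact ((h.cont_x q.1).comp (by fun_prop)).aestronglyMeasurable.smul hk
  · have hq : ∀ᶠ q in 𝓝 q₀, |q.1| < T ∧ ‖q.2‖ < ‖q₀.2‖ + 1 := by
      apply Filter.Eventually.and
      · exact (continuous_fst.abs.continuousAt (x := q₀)).eventually_lt continuousAt_const
          (by simp [T])
      · exact (continuous_snd.norm.continuousAt (x := q₀)).eventually_lt continuousAt_const
          (by simp)
    filter_upwards [hq] with q hq
    refine Eventually.of_forall fun z => ?_
    rw [norm_smul, Real.norm_eq_abs]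
    by_cases h0 : ρ q.1 (q.2 - z) = 0
    · rw [h0, abs_zero, zero_mul]
      have := tp_nonneg 2 r z
      positivity
    · have h1 := h.supp _ _ h0
      have h2 := h.bd q.1 (q.2 - z)
      have h3 : ‖z‖ < r := by
        have := norm_sub_norm_le z q.2
        rw [norm_sub_rev] at this
        have : (R + 3) * (1 + |q.1|) ≤ (R + 3) * (1 + T) := by gcongr; exact hq.1.le
        linarith [hq.2]
      have h4 := hkb z
      rw [tp_eq h3]
      have h5 : c * ‖z‖ ^ (-2 : ℝ) ≤ |c| * ‖z‖ ^ (-2 : ℝ) := by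
        gcongr; exact le_abs_self c
      have h6 : A * w3 q.1 ≤ A * 1 := by gcongr; exact w3_le_one _
      gcongr
      · linarith
      · exact h4.trans h5
  · exact ((tp_integrable (by norm_num) hr).const_mul _).const_mul _
  · refine Eventually.of_forall fun z => ?_
    refine ContinuousAt.smul ?_ continuousAt_const
    exact (h.cont.comp (by fun_prop : Continuous (fun q : ℝ × E3 => (q.1, q.2 - z)))).continuousAt

lemma fld_joint_cont {A R : ℝ} {ρ : ℝ → E3 → ℝ} (h : GoodDens A R ρ) (hR : 0 < R) :
    Continuous (fun q : ℝ × E3 => fld (ρ q.1) q.2) :=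
  conv_joint_cont h hR KK_meas.aestronglyMeasurable (c := 1) (fun a => by rw [KK_norm, one_mul])

/-- Constant governing the smallness. -/
def Mc (R : ℝ) : ℝ := Cp 2 * (R + 3) + 6 * cc + 6 * Cp (5 / 2) * √(R + 3)

lemma Mc_pos {R : ℝ} (hR : 0 < R) : 0 < Mc R := by
  have h1 := cc_pos
  have h2 := Cp_pos (p := 2) (by norm_num)
  have h3 := Cp_pos (p := 5 / 2) (by norm_num)
  unfold Mc
  positivity

lemma four_pi_inv : 0 < (4 * π)⁻¹ ∧ (4 * π)⁻¹ ≤ 1 := by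
  have := Real.pi_gt_three
  refine ⟨by positivity, inv_le_one_of_one_le₀ (by linarith)⟩

/-- The field created by a density, reflected in time. -/
def newB (β : ℝ) (ρ : ℝ → E3 → ℝ) (q : ℝ × E3) : E3 :=
  β • ((4 * π)⁻¹ • fld (ρ |q.1|) q.2)

lemma scal_norm {β : ℝ} (hβ : |β| = 1) (a : E3) : ‖β • ((4 * π)⁻¹ • a)‖ ≤ ‖a‖ := by
  have h := four_pi_inv
  rw [norm_smul, norm_smul, Real.norm_eq_abs, hβ, one_mul, Real.norm_of_nonneg h.1.le]
  have := norm_nonneg a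
  nlinarith [h.2]

lemma w3_w2 (t : ℝ) : w3 t * (1 + |t|) = w2 t := by
  unfold w3 w2
  have : 0 < 1 + |t| := by positivity
  field_simp

lemma w3_wt (t : ℝ) : w3 t * √(1 + |t|) = wt t := by
  unfold w3 wt
  have h : 0 < 1 + |t| := by positivity
  have h2 : 0 < √(1 + |t|) := Real.sqrt_pos.2 h
  have h3 := Real.sq_sqrt h.le
  field_simp
  nlinarith

lemma w3_le_wt (t : ℝ) : w3 t ≤ wt t := by
  rw [← w3_wt]
  have : 1 ≤ √(1 + |t|) := by
    rw [Real.one_le_sqrt]; linarith [abs_nonneg t]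
  have := w3_pos t
  nlinarith

lemma newB_good {A R β : ℝ} (hβ : |β| = 1) {ρ : ℝ → E3 → ℝ} (h : GoodDens A R ρ) (hR : 0 < R)
    (hA : A * Mc R ≤ 1 / 8) : GoodField (1 / 8) (newB β ρ) := by
  have hA0 := h.A_nonneg
  have c1 := cc_pos
  have c2 := Cp_pos (p := 2) (by norm_num)
  have c3 := Cp_pos (p := 5 / 2) (by norm_num)
  refine ⟨?_, ?_, ?_⟩
  · unfold newB
    have := (fld_joint_cont h hR).comp
      (by fun_prop : Continuous (fun q : ℝ × E3 => (|q.1|, q.2)))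
    exact (this.const_smul (4 * π)⁻¹).const_smul β
  · intro t x
    refine (scal_norm hβ _).trans ?_
    refine (fld_bound (L := (R + 3) * (1 + |t|)) (by positivity) (h.bd _)
      (by simpa using h.supp |t|) x).trans ?_
    have e : w3 |t| = w3 t := by simp [w3]
    rw [e]
    calc A * w3 t * (Cp 2 * ((R + 3) * (1 + |t|))) = A * (Cp 2 * (R + 3)) * w2 t := by
          rw [← w3_w2]; ring
      _ ≤ A * Mc R * w2 t := by
          have := (w2_pos t).le
          gcongr
          unfold Mc
          have : 0 ≤ 6 * cc + 6 * Cp (5 / 2) * √(R + 3) := by positivity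
          linarith
      _ ≤ _ := by
          have := (w2_pos t).le
          gcongr
  · intro t x y
    rw [newB, newB, ← smul_sub, ← smul_sub]
    refine (scal_norm hβ _).trans ?_
    refine (fld_lip (h.cont_x _) (L := (R + 3) * (1 + |t|)) (by positivity) (h.bd _)
      (by simpa using h.supp |t|) (h.lip _) x y).trans ?_
    have e : w3 |t| = w3 t := by simp [w3]
    simp only [e]
    gcongr
    rw [Real.sqrt_mul (by positivity)]
    calc 3 * cc * (2 * A * w3 t) + 6 * (A * w3 t) * Cp (5 / 2) * (√(R + 3) * √(1 + |t|))
        = A * (6 * cc) * w3 t + A * (6 * Cp (5 / 2) * √(R + 3)) * wt t := by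
          rw [← w3_wt]; ring
      _ ≤ A * (6 * cc) * wt t + A * (6 * Cp (5 / 2) * √(R + 3)) * wt t := by
          gcongr
          exact w3_le_wt t
      _ = A * (6 * cc + 6 * Cp (5 / 2) * √(R + 3)) * wt t := by ring
      _ ≤ A * Mc R * wt t := by
          have := (wt_pos t).le
          gcongr
          unfold Mc
          have : 0 ≤ Cp 2 * (R + 3) := by positivity
          linarith
      _ ≤ _ := by
          have := (wt_pos t).le
          gcongr

lemma newB_contr {ε R β : ℝ} (hβ : |β| = 1) (hR : 0 < R)
    (hA : ε * kap R * Mc R ≤ 1 / 8) {f₀ : E3 × E3 → ℝ} (hf : GoodData ε R f₀)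
    {B B' : ℝ × E3 → E3} (h : GoodField (1 / 8) B) (h' : GoodField (1 / 8) B')
    {d : ℝ} (hd : 0 ≤ d) (hBB : ∀ z, ‖B z - B' z‖ ≤ d) (q : ℝ × E3) :
    ‖newB β (vpDensity (FF f₀ B)) q - newB β (vpDensity (FF f₀ B')) q‖ ≤ 1 / 2 * d := by
  obtain ⟨t, x⟩ := q
  rw [newB, newB, ← smul_sub, ← smul_sub]
  refine (scal_norm hβ _).trans ?_
  have g := goodDens h le_rfl hR hf
  have g' := goodDens h' le_rfl hR hf
  have c1 := cc_pos
  have c2 := Cp_pos (p := 2) (by norm_num)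
  have c3 := Cp_pos (p := 5 / 2) (by norm_num)
  have hA0 := g.A_nonneg
  refine (fld_sub_le (g.cont_x _) (g'.cont_x _) (L := (R + 3) * (1 + |t|)) (by positivity)
    (dens_diff h h' le_rfl hR hf hd hBB _) (g.bd _) (g'.bd _)
    (by simpa using g.supp |t|) (by simpa using g'.supp |t|) x).trans ?_
  rw [abs_abs]
  have : 0 < 1 + |t| := by positivity
  calc 2 * (ε * kap R) * d * (1 + |t|)⁻¹ * (Cp 2 * ((R + 3) * (1 + |t|)))
      = 2 * d * (ε * kap R * (Cp 2 * (R + 3))) := by field_simp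
    _ ≤ 2 * d * (ε * kap R * Mc R) := by
        gcongr
        unfold Mc
        have : 0 ≤ 6 * cc + 6 * Cp (5 / 2) * √(R + 3) := by positivity
        linarith
    _ ≤ 2 * d * (1 / 8) := by gcongr
    _ ≤ _ := by linarith

/-- Existence of the self-consistent field. -/
lemma exists_field {ε R β : ℝ} (hβ : |β| = 1) (hR : 0 < R)
    (hA : ε * kap R * Mc R ≤ 1 / 8) {f₀ : E3 × E3 → ℝ} (hf : GoodData ε R f₀) :
    ∃ B : ℝ × E3 → E3, GoodField (1 / 8) B ∧ newB β (vpDensity (FF f₀ B)) = B := by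
  let S : Set (BoundedContinuousFunction (ℝ × E3) E3) := {B | GoodField (1 / 8) B}
  have hS : IsClosed S := by
    have e : S = (⋂ (t : ℝ) (x : E3), {B : BoundedContinuousFunction (ℝ × E3) E3 |
        ‖B (t, x)‖ ≤ 1 / 8 * w2 t}) ∩ ⋂ (t : ℝ) (x : E3) (y : E3),
        {B : BoundedContinuousFunction (ℝ × E3) E3 |
          ‖B (t, x) - B (t, y)‖ ≤ 1 / 8 * wt t * ‖x - y‖} := by
      ext B
      simp only [Set.mem_inter_iff, Set.mem_iInter, Set.mem_ofPred_eq, S]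
      exact ⟨fun h => ⟨h.bd, h.lip⟩, fun h => ⟨B.continuous, h.1, h.2⟩⟩
    rw [e]
    have hc : ∀ q : ℝ × E3, Continuous
        (fun B : BoundedContinuousFunction (ℝ × E3) E3 => B q) := fun q =>
      by fun_prop
    apply IsClosed.inter
    · exact isClosed_iInter fun t => isClosed_iInter fun x =>
        isClosed_le (hc _).norm continuous_const
    · exact isClosed_iInter fun t => isClosed_iInter fun x => isClosed_iInter fun y =>
        isClosed_le ((hc _).sub (hc _)).norm continuous_const
  have hgood : ∀ {B : ℝ × E3 → E3}, GoodField (1 / 8) B →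
      GoodField (1 / 8) (newB β (vpDensity (FF f₀ B))) := fun h =>
    newB_good hβ (goodDens h le_rfl hR hf) hR hA
  have hbd : ∀ {B : ℝ × E3 → E3}, GoodField (1 / 8) B → ∀ z, ‖B z‖ ≤ 1 := fun h z => by
    have h1 := h.bd z.1 z.2
    have h2 := w2_le_one z.1
    have : ‖_‖ ≤ _ := h1
    linarith
  let mk : ∀ B : ℝ × E3 → E3, GoodField (1 / 8) B → BoundedContinuousFunction (ℝ × E3) E3 :=
    fun B h => BoundedContinuousFunction.ofNormedAddCommGroup B h.cont 1 (hbd h)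
  let Φ : S → S := fun B => ⟨mk _ (hgood B.2), hgood B.2⟩
  have : CompleteSpace S := hS.completeSpace_coe
  have hz : GoodField (1 / 8) (fun _ : ℝ × E3 => (0 : E3)) := by
    refine ⟨continuous_const, fun t x => ?_, fun t x y => ?_⟩
    · have := w2_pos t
      simp; positivity
    · have := wt_pos t
      simp; positivity
  have : Nonempty S := ⟨⟨mk _ hz, hz⟩⟩
  have hΦ : ContractingWith (1 / 2) Φ := by
    refine ⟨by rw [← NNReal.coe_lt_coe]; norm_num, LipschitzWith.of_dist_le_mul fun B B' => ?_⟩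
    rw [Subtype.dist_eq, Subtype.dist_eq, BoundedContinuousFunction.dist_le (by positivity)]
    intro q
    rw [dist_eq_norm]
    have := newB_contr hβ hR hA hf B.2 B'.2 (d := dist B.1 B'.1) dist_nonneg (by
      intro z
      rw [← dist_eq_norm]
      exact BoundedContinuousFunction.dist_coe_le_dist z) q
    have e : ((1 / 2 : NNReal) : ℝ) = 1 / 2 := by norm_num
    rw [e]
    exact this
  refine ⟨(ContractingWith.fixedPoint Φ hΦ).1, (ContractingWith.fixedPoint Φ hΦ).2, ?_⟩
  have := ContractingWith.fixedPoint_isFixedPt hΦ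
  have h2 := congrArg (fun B : S => ((B.1 : BoundedContinuousFunction (ℝ × E3) E3) : ℝ × E3 → E3)) this
  exact h2


/-! ## Part 5: differentiability of the field -/

/-- Kernel cut off smoothly near the origin. -/
def Kr (r : ℝ) (a : E3) : E3 := Real.smoothTransition (‖a‖ ^ 2 / r ^ 2 - 1) • KK a

lemma Kr_zero {r : ℝ} (hr : 0 < r) {a : E3} (ha : ‖a‖ ≤ r) : Kr r a = 0 := by
  unfold Kr
  rw [Real.smoothTransition.zero_of_nonpos, zero_smul]
  rw [sub_nonpos, div_le_one (by positivity)]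
  gcongr

lemma Kr_norm (r : ℝ) (a : E3) : ‖Kr r a‖ ≤ ‖KK a‖ := by
  unfold Kr
  rw [norm_smul, Real.norm_of_nonneg (Real.smoothTransition.nonneg _)]
  have := Real.smoothTransition.le_one (‖a‖ ^ 2 / r ^ 2 - 1)
  have := norm_nonneg (KK a)
  nlinarith

lemma Kr_sub {r : ℝ} (hr : 0 < r) (a : E3) : ‖Kr r a - KK a‖ ≤ tp 2 (2 * r) a := by
  by_cases h : ‖a‖ < 2 * r
  · rw [tp_eq h, ← KK_norm]
    have e : Kr r a - KK a = (Real.smoothTransition (‖a‖ ^ 2 / r ^ 2 - 1) - 1) • KK a := by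
      rw [Kr, sub_smul, one_smul]
    rw [e, norm_smul, Real.norm_eq_abs]
    have h1 := Real.smoothTransition.le_one (‖a‖ ^ 2 / r ^ 2 - 1)
    have h2 := Real.smoothTransition.nonneg (‖a‖ ^ 2 / r ^ 2 - 1)
    have h3 := norm_nonneg (KK a)
    have h4 : |(‖a‖ ^ 2 / r ^ 2 - 1).smoothTransition - 1| ≤ 1 := by
      rw [abs_le]; constructor <;> linarith
    nlinarith
  · push Not at h
    have : Kr r a = KK a := by
      unfold Kr
      rw [Real.smoothTransition.one_of_one_le, one_smul]
      rw [le_sub_iff_add_le, le_div_iff₀ (by positivity)]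
      nlinarith
    rw [this, sub_self, norm_zero]
    exact tp_nonneg _ _ _

lemma KK_contDiffAt {a : E3} (ha : a ≠ 0) : ContDiffAt ℝ 1 KK a := by
  unfold KK
  have h1 : ContDiffAt ℝ 1 (fun a : E3 => ‖a‖) a := contDiffAt_norm ℝ ha
  exact ((h1.pow 3).inv (by simpa using ha)).smul contDiffAt_id

lemma Kr_contDiff {r : ℝ} (hr : 0 < r) : ContDiff ℝ 1 (Kr r) := by
  rw [contDiff_iff_contDiffAt]
  intro a
  by_cases ha : a = 0
  · have : Kr r =ᶠ[𝓝 a] fun _ => 0 := by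
      have : Metric.ball (0 : E3) r ∈ 𝓝 a := by rw [ha]; exact Metric.ball_mem_nhds _ hr
      filter_upwards [this] with b hb
      exact Kr_zero hr (by rw [mem_ball_zero_iff] at hb; exact hb.le)
    exact contDiffAt_const.congr_of_eventuallyEq this
  · unfold Kr
    have h2 : ContDiff ℝ 1 (fun a : E3 => ‖a‖ ^ 2 / r ^ 2 - 1) := by
      have : ContDiff ℝ 1 (fun a : E3 => ‖a‖ ^ 2) := contDiff_norm_sq ℝ
      fun_prop
    have h3 : ContDiff ℝ 1 (fun a : E3 => Real.smoothTransition (‖a‖ ^ 2 / r ^ 2 - 1)) :=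
      Real.smoothTransition.contDiff.comp h2
    exact h3.contDiffAt.smul (KK_contDiffAt ha)

lemma conv_to_compact {A R : ℝ} {ρ : ℝ → E3 → ℝ} (h : GoodDens A R ρ) (hR : 0 < R)
    {V : Type*} [NormedAddCommGroup V] [NormedSpace ℝ V] (k : E3 → V) {t T : ℝ} (ht : |t| ≤ T)
    (x : E3) :
    ∫ y, ρ t y • k (x - y)
      = ∫ y in Metric.closedBall 0 ((R + 3) * (1 + T)), ρ t y • k (x - y) := by
  rw [setIntegral_eq_integral_of_forall_compl_eq_zero]
  intro y hy
  have : ρ t y = 0 := by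
    by_contra hc
    apply hy
    rw [mem_closedBall_zero_iff]
    refine (h.supp t y hc).le.trans ?_
    gcongr
  rw [this, zero_smul]

lemma conv_cont_kernel {A R : ℝ} {ρ : ℝ → E3 → ℝ} (h : GoodDens A R ρ) (hR : 0 < R)
    {V : Type*} [NormedAddCommGroup V] [NormedSpace ℝ V] {k : E3 → V} (hk : Continuous k) :
    Continuous (fun q : ℝ × E3 => ∫ y, ρ q.1 y • k (q.2 - y)) := by
  rw [continuous_iff_continuousAt]
  intro q₀
  have hc : Continuous (fun q : ℝ × E3 =>
      ∫ y in Metric.closedBall 0 ((R + 3) * (1 + (|q₀.1| + 1))), ρ q.1 y • k (q.2 - y)) := by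
    apply continuous_parametric_integral_of_continuous
      (f := fun (q : ℝ × E3) y => ρ q.1 y • k (q.2 - y)) _ (isCompact_closedBall _ _)
    exact (h.cont.comp (by fun_prop : Continuous (fun p : (ℝ × E3) × E3 => (p.1.1, p.2)))).smul
      (hk.comp (by fun_prop))
  refine hc.continuousAt.congr ?_
  have : ∀ᶠ q : ℝ × E3 in 𝓝 q₀, |q.1| < |q₀.1| + 1 :=
    (continuous_fst.abs.continuousAt (x := q₀)).eventually_lt continuousAt_const (by simp)
  filter_upwards [this] with q hq
  exact (conv_to_compact h hR k hq.le q.2).symm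

lemma conv_hasFDeriv {A R : ℝ} {ρ : ℝ → E3 → ℝ} (h : GoodDens A R ρ) (hR : 0 < R)
    {k : E3 → E3} (hk : ContDiff ℝ 1 k) (t : ℝ) (x : E3) :
    HasFDerivAt (fun x => ∫ y, ρ t y • k (x - y)) (∫ y, ρ t y • fderiv ℝ k (x - y)) x := by
  have e1 := conv_to_compact h hR k (le_refl |t|)
  have e2 := conv_to_compact h hR (fderiv ℝ k) (le_refl |t|) x
  simp only [e1]
  rw [e2]
  set K := Metric.closedBall (0 : E3) ((R + 3) * (1 + |t|)) with hK
  have hKc : IsCompact K := isCompact_closedBall _ _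
  have hdk : Continuous (fderiv ℝ k) := hk.continuous_fderiv (by norm_num)
  obtain ⟨M, hM⟩ := (isCompact_closedBall (0 : E3)
    (‖x‖ + 1 + (R + 3) * (1 + |t|))).exists_bound_of_continuousOn hdk.continuousOn
  have hA := h.A_nonneg
  have hr := h.cont_x t
  have hfin : volume K ≠ ⊤ := hKc.measure_lt_top.ne
  apply hasFDerivAt_integral_of_dominated_of_fderiv_le (bound := fun _ => A * M)
    (s := Metric.ball x 1) (F' := fun x y => ρ t y • fderiv ℝ k (x - y))
    (Metric.ball_mem_nhds x one_pos)
  · exact Eventually.of_forall fun x' =>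
      (hr.smul (hk.continuous.comp (by fun_prop))).aestronglyMeasurable
  · exact (hr.smul (hk.continuous.comp (by fun_prop))).continuousOn.integrableOn_compact hKc
  · exact (hr.smul (hdk.comp (by fun_prop))).aestronglyMeasurable
  · refine (ae_restrict_mem hKc.measurableSet).mono fun y hy x' hx' => ?_
    rw [norm_smul, Real.norm_eq_abs]
    have h1 : |ρ t y| ≤ A := by
      refine (h.bd t y).trans ?_
      have := w3_le_one t
      nlinarith
    have h2 : ‖fderiv ℝ k (x' - y)‖ ≤ M := by
      apply hM
      rw [mem_closedBall_zero_iff]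
      rw [hK, mem_closedBall_zero_iff] at hy
      rw [mem_ball_iff_norm] at hx'
      have := norm_sub_le x' y
      have := norm_sub_norm_le x' x
      linarith
    gcongr
  · exact integrableOn_const hfin
  · refine Eventually.of_forall fun y x' _ => ?_
    have hd : HasFDerivAt k (fderiv ℝ k (x' - y)) (x' - y) :=
      (hk.differentiable (by norm_num) _).hasFDerivAt
    have := (hd.comp x' ((hasFDerivAt_id x').sub_const y)).const_smul (ρ t y)
    rw [ContinuousLinearMap.comp_id] at this
    exact this

lemma le_of_lip' {f : E3 → E3} {f' : E3 →L[ℝ] E3} {x : E3} (hf : HasFDerivAt f f' x) {C : ℝ}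
    (hC : 0 ≤ C) (h : ∀ y, ‖f y - f x‖ ≤ C * ‖y - x‖) : ‖f'‖ ≤ C :=
  hf.le_of_lip' hC (Eventually.of_forall h)

lemma fld_deriv {A R : ℝ} {ρ : ℝ → E3 → ℝ} (h : GoodDens A R ρ) (hR : 0 < R) :
    ∃ D : ℝ × E3 → (E3 →L[ℝ] E3), Continuous D ∧
      ∀ t x, HasFDerivAt (fld (ρ t)) (D (t, x)) x := by
  have hA := h.A_nonneg
  have c1 := cc_pos
  let r : ℕ → ℝ := fun n => 1 / ((n : ℝ) + 1)
  have hr : ∀ n, 0 < r n := fun n => by positivity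
  have hrl : Tendsto r atTop (𝓝 0) := tendsto_one_div_add_atTop_nhds_zero_nat
  let f : ℕ → ℝ × E3 → E3 := fun n q => ∫ y, ρ q.1 y • Kr (r n) (q.2 - y)
  let f' : ℕ → ℝ × E3 → (E3 →L[ℝ] E3) := fun n q => ∫ y, ρ q.1 y • fderiv ℝ (Kr (r n)) (q.2 - y)
  have hf'c : ∀ n, Continuous (f' n) := fun n =>
    conv_cont_kernel h hR ((Kr_contDiff (hr n)).continuous_fderiv (by norm_num))
  have hd : ∀ n t x, HasFDerivAt (fun x => f n (t, x)) (f' n (t, x)) x := fun n t x =>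
    conv_hasFDeriv h hR (Kr_contDiff (hr n)) t x
  -- integrability
  have hL : ∀ t : ℝ, 0 < (R + 3) * (1 + |t|) := fun t => by positivity
  have hKi : ∀ t x, Integrable (fun y => ρ t y • KK (x - y)) := fun t x =>
    fld_integrable (h.cont_x t).aestronglyMeasurable (hL t) (h.bd t) (h.supp t) x
  have hKri : ∀ n t x, Integrable (fun y => ρ t y • Kr (r n) (x - y)) := fun n t x =>
    conv_integrable (p := 2) (c := 1) (by norm_num) (by norm_num) (hL t)
      ((abs_nonneg _).trans (h.bd t 0)) zero_le_one (h.cont_x t).aestronglyMeasurable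
      (h.bd t) (h.supp t) x
      (((Kr_contDiff (hr n)).continuous).comp (by fun_prop)).aestronglyMeasurable
      (Eventually.of_forall fun y => by rw [one_mul, ← KK_norm]; exact Kr_norm _ _)
  have hfsub : ∀ n t x, f n (t, x) - fld (ρ t) x
      = ∫ y, ρ t y • (Kr (r n) (x - y) - KK (x - y)) := by
    intro n t x
    simp only [f, fld, smul_sub]
    rw [integral_sub (hKri n t x) (hKi t x)]
  have hrb : ∀ t y, |ρ t y| ≤ A := fun t y => by
    refine (h.bd t y).trans ?_
    have := w3_le_one t
    nlinarith
  have hrl' : ∀ t y y', |ρ t y - ρ t y'| ≤ 2 * A * ‖y - y'‖ := fun t y y' => by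
    refine (h.lip t y y').trans ?_
    have := w3_le_one t
    have : 2 * A * w3 t ≤ 2 * A * 1 := by gcongr
    rw [mul_one] at this
    gcongr
  set C : ℝ := 2 * A * (3 * cc * 2) with hC
  have hC0 : 0 ≤ C := by positivity
  have hlip : ∀ n t x x', ‖(f n (t, x) - fld (ρ t) x) - (f n (t, x') - fld (ρ t) x')‖
      ≤ C * r n * ‖x - x'‖ := by
    intro n t x x'
    rw [hfsub, hfsub]
    have := conv_short_lip (k := fun a => Kr (r n) a - KK a)
      ((Kr_contDiff (hr n)).continuous.measurable.sub KK_meas).aestronglyMeasurable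
      (r := 2 * r n) (by have := hr n; positivity) (Kr_sub (hr n)) (h.cont_x t) (hrb t)
      (hrl' t) x x'
    refine this.trans (le_of_eq ?_)
    rw [hC]; ring
  have hcauchy : ∀ n m q, ‖f' n q - f' m q‖ ≤ C * r n + C * r m := by
    rintro n m ⟨t, x⟩
    have hn := hr n
    have hm := hr m
    apply le_of_lip' ((hd n t x).sub (hd m t x)) (by positivity)
    intro y
    have h1 := hlip n t y x
    have h2 := hlip m t y x
    have e : (f n (t, y) - f m (t, y)) - (f n (t, x) - f m (t, x))
      = ((f n (t, y) - fld (ρ t) y) - (f n (t, x) - fld (ρ t) x))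
        - ((f m (t, y) - fld (ρ t) y) - (f m (t, x) - fld (ρ t) x)) := by abel
    have h3 := norm_sub_le ((f n (t, y) - fld (ρ t) y) - (f n (t, x) - fld (ρ t) x))
      ((f m (t, y) - fld (ρ t) y) - (f m (t, x) - fld (ρ t) x))
    rw [← e] at h3
    refine h3.trans ?_
    linarith
  have hex : ∀ q, ∃ D, Tendsto (fun n => f' n q) atTop (𝓝 D) := by
    intro q
    apply cauchySeq_tendsto_of_complete
    have hb : Tendsto (fun p : ℕ × ℕ => C * r p.1 + C * r p.2) atTop (𝓝 0) := by
      have := (hrl.comp (tendsto_fst (f := atTop) (g := (atTop : Filter ℕ)))).const_mul C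
      have h2 := (hrl.comp (tendsto_snd (f := (atTop : Filter ℕ)) (g := atTop))).const_mul C
      have := this.add h2
      rw [prod_atTop_atTop_eq] at this
      simpa using this
    rw [Metric.cauchySeq_iff']
    intro e he
    have h3 : ∀ᶠ n in atTop, C * r n < e / 2 := by
      have := hrl.const_mul C
      rw [mul_zero] at this
      exact this.eventually_lt_const (by positivity)
    obtain ⟨N, hN⟩ := eventually_atTop.1 h3
    refine ⟨N, fun n hn => ?_⟩
    rw [dist_eq_norm]
    have := hcauchy n N q
    linarith [hN n hn, hN N le_rfl]
  choose D hD using hex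
  have hDn : ∀ n q, ‖f' n q - D q‖ ≤ C * r n := by
    intro n q
    have h1 : Tendsto (fun m => ‖f' n q - f' m q‖) atTop (𝓝 ‖f' n q - D q‖) :=
      ((hD q).const_sub _).norm
    have h2 : Tendsto (fun m => C * r n + C * r m) atTop (𝓝 (C * r n + C * 0)) :=
      (hrl.const_mul C).const_add _
    have := le_of_tendsto_of_tendsto' h1 h2 (fun m => hcauchy n m q)
    simpa using this
  have hunif : TendstoUniformly f' D atTop := by
    rw [Metric.tendstoUniformly_iff]
    intro e he
    have h3 : ∀ᶠ n in atTop, C * r n < e := by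
      have := hrl.const_mul C
      rw [mul_zero] at this
      exact this.eventually_lt_const he
    filter_upwards [h3] with n hn q
    rw [dist_comm, dist_eq_norm]
    exact (hDn n q).trans_lt hn
  refine ⟨D, hunif.continuous (Eventually.of_forall hf'c).frequently, fun t x => ?_⟩
  refine hasFDerivAt_of_tendstoUniformly (l := atTop) (f := fun n x => f n (t, x))
    (f' := fun n x => f' n (t, x)) (g' := fun x => D (t, x)) ?_
    (fun n x => hd n t x) ?_ x
  · exact hunif.comp (fun x => (t, x))
  · intro x
    rw [tendsto_iff_norm_sub_tendsto_zero]
    have hb : ∀ n, ‖f n (t, x) - fld (ρ t) x‖ ≤ A * (3 * cc * (2 * r n)) := by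
      intro n
      rw [hfsub]
      have hr2 : 0 < 2 * r n := by have := hr n; positivity
      refine (norm_integral_le_of_norm_le (g := fun y => A * tp 2 (2 * r n) (x - y))
        (((tp_integrable (by norm_num) hr2).comp_sub_left x).const_mul A)
        (Eventually.of_forall fun y => ?_)).trans ?_
      · rw [norm_smul, Real.norm_eq_abs]
        have h1 := hrb t y
        have h2 := Kr_sub (hr n) (x - y)
        gcongr
      · rw [integral_const_mul, integral_sub_left_eq_self (fun z => tp 2 (2 * r n) z) volume x,
          tp_integral (by norm_num) hr2]
        apply le_of_eq
        norm_num
    refine squeeze_zero (fun _ => norm_nonneg _) hb ?_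
    have := ((hrl.const_mul 2).const_mul (3 * cc)).const_mul A
    simpa using this

/-- Good field with a jointly continuous space derivative. -/
structure C1Field (B : ℝ × E3 → E3) (D : ℝ × E3 → (E3 →L[ℝ] E3)) : Prop extends
    GoodField (1 / 8) B where
  dcont : Continuous D
  deriv : ∀ t x, HasFDerivAt (fun x => B (t, x)) (D (t, x)) x

lemma newB_C1 {A R β : ℝ} (hβ : |β| = 1) {ρ : ℝ → E3 → ℝ} (h : GoodDens A R ρ) (hR : 0 < R)
    (hA : A * Mc R ≤ 1 / 8) : ∃ D, C1Field (newB β ρ) D := by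
  obtain ⟨D, h1, h2⟩ := fld_deriv h hR
  refine ⟨fun q => β • ((4 * π)⁻¹ • D (|q.1|, q.2)), newB_good hβ h hR hA, ?_, ?_⟩
  · have := h1.comp (by fun_prop : Continuous (fun q : ℝ × E3 => (|q.1|, q.2)))
    exact (this.const_smul (4 * π)⁻¹).const_smul β
  · intro t x
    exact ((h2 |t| x).const_smul (4 * π)⁻¹).const_smul β

lemma C1Field.D_norm {B : ℝ × E3 → E3} {D : ℝ × E3 → (E3 →L[ℝ] E3)} (h : C1Field B D)
    (t : ℝ) (x : E3) : ‖D (t, x)‖ ≤ 1 / 8 * wt t := by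
  have := (wt_pos t).le
  exact le_of_lip' (h.deriv t x) (by positivity) (fun y => h.lip t y x)


/-! ## Part 6: differentiability of the flow in phase space -/

section
variable {B : ℝ × E3 → E3} {D : ℝ × E3 → (E3 →L[ℝ] E3)}

/-- Free part of the linearised flow. -/
def linA (t : ℝ) (σ : unitInterval) : E3 × E3 →L[ℝ] E3 :=
  ContinuousLinearMap.fst ℝ E3 E3 + (((σ : ℝ) - 1) * t) • ContinuousLinearMap.snd ℝ E3 E3

lemma D_path_cont (h : C1Field B D) :
    Continuous (fun q : (ℝ × E3 × E3) × unitInterval => D (q.1.1 * q.2, flowY B q.1 q.2)) := by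
  have := flow_joint_cont h.toGoodField le_rfl
  exact h.dcont.comp (Continuous.prodMk (by fun_prop) this)

lemma exists_W (h : C1Field B D) :
    ∃ W : ℝ × E3 × E3 → C(unitInterval, E3 × E3 →L[ℝ] E3), Continuous W ∧
      ∀ (p : ℝ × E3 × E3) (σ : unitInterval), W p σ = linA p.1 σ +
        p.1 ^ 2 • ∫ η, kk σ η • (D (p.1 * η, flowY B p η)).comp (W p η) := by
  obtain ⟨W, h1, h2, -⟩ := volterra_fix (P := ℝ × E3 × E3) (B := E3 × E3 →L[ℝ] E3)
    (fun p => p.1) continuous_fst (fun p σ => linA p.1 σ) (by unfold linA; fun_prop)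
    (fun p η b => (D (p.1 * η, flowY B p η)).comp b) (by
      have h1 := (D_path_cont h).comp (by fun_prop : Continuous
        (fun q : (ℝ × E3 × E3) × unitInterval × (E3 × E3 →L[ℝ] E3) => (q.1, q.2.1)))
      exact h1.clm_comp (by fun_prop)) (by
      intro p η b b'
      rw [← ContinuousLinearMap.comp_sub]
      refine (ContinuousLinearMap.opNorm_comp_le _ _).trans ?_
      have h1 := h.D_norm (p.1 * η) (flowY B p η)
      have := (wt_pos (p.1 * η)).le
      gcongr
      linarith)
  exact ⟨W, h1, h2⟩

/-- Solution of the linearised flow equation. -/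
structure IsLinFlow (B : ℝ × E3 → E3) (D : ℝ × E3 → (E3 →L[ℝ] E3))
    (W : ℝ × E3 × E3 → C(unitInterval, E3 × E3 →L[ℝ] E3)) : Prop where
  cont : Continuous W
  eq : ∀ (p : ℝ × E3 × E3) (σ : unitInterval), W p σ = linA p.1 σ +
        p.1 ^ 2 • ∫ η, kk σ η • (D (p.1 * η, flowY B p η)).comp (W p η)

/-- Derivative of the initial velocity. -/
def DV (B : ℝ × E3 → E3) (D : ℝ × E3 → (E3 →L[ℝ] E3))
    (W : ℝ × E3 × E3 → C(unitInterval, E3 × E3 →L[ℝ] E3)) (p : ℝ × E3 × E3) :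
    E3 × E3 →L[ℝ] E3 :=
  ContinuousLinearMap.snd ℝ E3 E3
    - p.1 • ∫ η : unitInterval, (D (p.1 * η, flowY B p η)).comp (W p η)

variable {W : ℝ × E3 × E3 → C(unitInterval, E3 × E3 →L[ℝ] E3)}

lemma W_joint_cont (hW : IsLinFlow B D W) :
    Continuous (fun q : (ℝ × E3 × E3) × unitInterval => W q.1 q.2) := by
  have := hW.cont
  fun_prop

lemma DW_cont (h : C1Field B D) (hW : IsLinFlow B D W) :
    Continuous (fun q : (ℝ × E3 × E3) × unitInterval =>
      (D (q.1.1 * q.2, flowY B q.1 q.2)).comp (W q.1 q.2)) :=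
  (D_path_cont h).clm_comp (W_joint_cont hW)

lemma DV_cont (h : C1Field B D) (hW : IsLinFlow B D W) : Continuous (DV B D W) := by
  unfold DV
  refine Continuous.sub continuous_const (Continuous.smul continuous_fst ?_)
  exact cont_param (f := fun (p : ℝ × E3 × E3) (η : unitInterval) =>
    (D (p.1 * η, flowY B p η)).comp (W p η)) (DW_cont h hW)

/-- Taylor remainder of the field along the flow. -/
def rem (B : ℝ × E3 → E3) (D : ℝ × E3 → (E3 →L[ℝ] E3)) (t : ℝ) (z z' : E3 × E3)
    (η : unitInterval) : E3 :=
  B (t * η, flowY B (t, z') η) - B (t * η, flowY B (t, z) η)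
    - D (t * η, flowY B (t, z) η) (flowY B (t, z') η - flowY B (t, z) η)

/-- Error of the linearisation. -/
def err (B : ℝ × E3 → E3) (W : ℝ × E3 × E3 → C(unitInterval, E3 × E3 →L[ℝ] E3))
    (t : ℝ) (z z' : E3 × E3) : C(unitInterval, E3) :=
  flowY B (t, z') - flowY B (t, z) - ⟨fun σ => W (t, z) σ (z' - z), by fun_prop⟩

lemma err_apply (t : ℝ) (z z' : E3 × E3) (σ : unitInterval) :
    err B W t z z' σ = flowY B (t, z') σ - flowY B (t, z) σ - W (t, z) σ (z' - z) := rfl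

lemma D_path_cont' (h : C1Field B D) (p : ℝ × E3 × E3) :
    Continuous (fun η : unitInterval => D (p.1 * η, flowY B p η)) :=
  (D_path_cont h).comp (by fun_prop : Continuous (fun η : unitInterval => (p, η)))

lemma DW_cont' (h : C1Field B D) (hW : IsLinFlow B D W) (p : ℝ × E3 × E3) :
    Continuous (fun η : unitInterval => (D (p.1 * η, flowY B p η)).comp (W p η)) :=
  (DW_cont h hW).comp (by fun_prop : Continuous (fun η : unitInterval => (p, η)))

lemma kDW_cont' (h : C1Field B D) (hW : IsLinFlow B D W) (p : ℝ × E3 × E3) (σ : unitInterval) :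
    Continuous (fun η : unitInterval => kk σ η • (D (p.1 * η, flowY B p η)).comp (W p η)) :=
  (kk_cont.comp (by fun_prop : Continuous (fun η : unitInterval => (σ, η)))).smul
    (DW_cont' h hW p)

lemma rem_cont (h : C1Field B D) (t : ℝ) (z z' : E3 × E3) : Continuous (rem B D t z z') := by
  unfold rem
  exact ((h.path_cont t _).sub (h.path_cont t _)).sub
    ((D_path_cont' h (t, z)).clm_apply (by fun_prop))

lemma split_eq (t : ℝ) (z z' : E3 × E3) (η : unitInterval) :
    B (t * η, flowY B (t, z') η) - B (t * η, flowY B (t, z) η)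
      - D (t * η, flowY B (t, z) η) (W (t, z) η (z' - z))
    = rem B D t z z' η + D (t * η, flowY B (t, z) η) (err B W t z z' η) := by
  rw [rem, err_apply]
  simp only [map_sub]
  abel

lemma err_eq (h : C1Field B D) (hW : IsLinFlow B D W) (t : ℝ) (z z' : E3 × E3)
    (σ : unitInterval) :
    err B W t z z' σ = t ^ 2 • (∫ η, kk σ η • rem B D t z z' η) +
      t ^ 2 • ∫ η, kk σ η • D (t * η, flowY B (t, z) η) (err B W t z z' η) := by
  have hk : Continuous (fun η : unitInterval => kk σ η) :=
    kk_cont.comp (by fun_prop : Continuous (fun η : unitInterval => (σ, η)))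
  have c1 : Continuous (fun η => kk σ η • rem B D t z z' η) := hk.smul (rem_cont h t z z')
  have c2 : Continuous
      (fun η : unitInterval => kk σ η • D (t * η, flowY B (t, z) η) (err B W t z z' η)) :=
    hk.smul ((D_path_cont' h (t, z)).clm_apply (err B W t z z').continuous)
  rw [← smul_add, ← integral_add (ui_integrable c1) (ui_integrable c2)]
  simp only [← smul_add, ← split_eq]
  rw [err_apply]
  obtain ⟨x, v⟩ := z
  obtain ⟨x', v'⟩ := z'
  rw [flow_sub h.toGoodField h.toGoodField le_rfl, hW.eq]
  simp only [add_apply, smul_apply]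
  rw [ContinuousLinearMap.integral_apply (ui_integrable (kDW_cont' h hW (t, x, v) σ))]
  have c3 : Continuous (fun η : unitInterval => kk σ η •
      (B (t * η, flowY B (t, x', v') η) - B (t * η, flowY B (t, x, v) η))) :=
    hk.smul ((h.path_cont _ _).sub (h.path_cont _ _))
  have c4 := (kDW_cont' h hW (t, x, v) σ).clm_apply (continuous_const (y := ((x', v') - (x, v))))
  simp only [smul_sub (kk _ _) (_ - _) _]
  have e := integral_sub (ui_integrable c3) (ui_integrable c4)
  simp only [smul_apply, ContinuousLinearMap.comp_apply] at e ⊢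
  rw [e, smul_sub (t ^ 2)]
  simp only [linA, add_apply, smul_apply,
    ContinuousLinearMap.coe_fst', ContinuousLinearMap.coe_snd', Prod.mk_sub_mk]
  abel

lemma V0_err (h : C1Field B D) (hW : IsLinFlow B D W) (t : ℝ) (z z' : E3 × E3) :
    V0 B (t, z') - V0 B (t, z) - DV B D W (t, z) (z' - z)
      = - (t • (∫ η, rem B D t z z' η) +
        t • ∫ η : unitInterval, D (t * η, flowY B (t, z) η) (err B W t z z' η)) := by
  have c1 := rem_cont h t z z'
  have c2 : Continuous
      (fun η : unitInterval => D (t * η, flowY B (t, z) η) (err B W t z z' η)) :=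
    (D_path_cont' h (t, z)).clm_apply (err B W t z z').continuous
  rw [← smul_add, ← integral_add (ui_integrable c1) (ui_integrable c2)]
  simp only [← split_eq]
  obtain ⟨x, v⟩ := z
  obtain ⟨x', v'⟩ := z'
  rw [V0_diff h.toGoodField h.toGoodField, DV]
  simp only [sub_apply, smul_apply]
  rw [ContinuousLinearMap.integral_apply (ui_integrable (DW_cont' h hW (t, x, v)))]
  have c3 : Continuous (fun η : unitInterval =>
      (B (t * η, flowY B (t, x', v') η) - B (t * η, flowY B (t, x, v) η))) :=
    ((h.path_cont _ _).sub (h.path_cont _ _))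
  have c4 := (DW_cont' h hW (t, x, v)).clm_apply (continuous_const (y := ((x', v') - (x, v))))
  have e := integral_sub (ui_integrable c3) (ui_integrable c4)
  simp only [ContinuousLinearMap.comp_apply] at e ⊢
  rw [e, smul_sub]
  simp only [ContinuousLinearMap.coe_snd', Prod.mk_sub_mk]
  abel

lemma flow_z_dep' (h : C1Field B D) (t : ℝ) (z z' : E3 × E3) :
    ‖flowY B (t, z') - flowY B (t, z)‖ ≤ 2 * (1 + |t|) * ‖z' - z‖ := by
  obtain ⟨x, v⟩ := z
  obtain ⟨x', v'⟩ := z'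
  refine (flow_z_dep h.toGoodField le_rfl t x' v' x v).trans ?_
  have h1 : ‖x' - x‖ ≤ ‖(x', v') - (x, v)‖ := by
    rw [Prod.mk_sub_mk]; exact norm_fst_le (x' - x, v' - v)
  have h2 : ‖v' - v‖ ≤ ‖(x', v') - (x, v)‖ := by
    rw [Prod.mk_sub_mk]; exact norm_snd_le (x' - x, v' - v)
  have := mul_le_mul_of_nonneg_left h2 (abs_nonneg t)
  linarith

lemma rem_small (h : C1Field B D) (t : ℝ) (z : E3 × E3) {c : ℝ} (hc : 0 < c) :
    ∀ᶠ z' in 𝓝 z, ∀ η, ‖rem B D t z z' η‖ ≤ c * (2 * (1 + |t|) * ‖z' - z‖) := by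
  have hK : IsCompact (Set.range (fun η : unitInterval => (t * (η : ℝ), flowY B (t, z) η))) :=
    isCompact_range (by fun_prop)
  have hu := hK.uniformContinuousAt_of_continuousAt D (fun a _ => h.dcont.continuousAt)
    (Metric.dist_mem_uniformity hc)
  obtain ⟨s, hs, hsu⟩ := Metric.mem_uniformity_dist.1 hu
  have hsmall : ∀ᶠ z' in 𝓝 z, 2 * (1 + |t|) * ‖z' - z‖ < s := by
    have hcont : Continuous (fun z' : E3 × E3 => 2 * (1 + |t|) * ‖z' - z‖) := by fun_prop
    exact hcont.continuousAt.eventually_lt continuousAt_const (by simpa using hs)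
  filter_upwards [hsmall] with z' hz' η
  have hY := flow_z_dep' h t z z'
  have hYη : ‖flowY B (t, z') η - flowY B (t, z) η‖ ≤ 2 * (1 + |t|) * ‖z' - z‖ :=
    ((flowY B (t, z') - flowY B (t, z)).norm_coe_le_norm η).trans hY
  have hmv := (convex_ball (flowY B (t, z) η) s).norm_image_sub_le_of_norm_hasFDerivWithin_le'
    (f := fun x => B (t * η, x)) (f' := fun x => D (t * η, x))
    (φ := D (t * η, flowY B (t, z) η)) (C := c)
    (fun x _ => (h.deriv (t * η) x).hasFDerivWithinAt) (by
      intro x hx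
      have h3 : dist ((t * (η : ℝ), flowY B (t, z) η) : ℝ × E3) (t * (η : ℝ), x) < s := by
        rw [Prod.dist_eq, dist_self]
        rw [Metric.mem_ball, dist_comm] at hx
        exact max_lt hs hx
      have h2 := hsu h3 ⟨η, rfl⟩
      rw [← dist_eq_norm, dist_comm]
      exact (show dist _ _ < c from h2).le)
    (x := flowY B (t, z) η) (y := flowY B (t, z') η) (Metric.mem_ball_self hs) (by
      rw [mem_ball_iff_norm]; exact hYη.trans_lt hz')
  refine hmv.trans ?_
  gcongr

lemma Derr_bound (h : C1Field B D) (t : ℝ) (z z' : E3 × E3) (η : unitInterval) :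
    ‖D (t * η, flowY B (t, z) η) (err B W t z z' η)‖
      ≤ (1 / 8 * ‖err B W t z z'‖) * wt (t * η) := by
  refine (ContinuousLinearMap.le_opNorm _ _).trans ?_
  have h1 := h.D_norm (t * η) (flowY B (t, z) η)
  have h2 := (err B W t z z').norm_coe_le_norm η
  have := (wt_pos (t * η)).le
  calc _ ≤ (1 / 8 * wt (t * η)) * ‖err B W t z z'‖ := by gcongr
    _ = _ := by ring

lemma err_small (h : C1Field B D) (hW : IsLinFlow B D W) (t : ℝ) (z : E3 × E3) {c : ℝ}
    (hc : 0 < c) :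
    ∀ᶠ z' in 𝓝 z, ‖err B W t z z'‖ ≤ c * ‖z' - z‖ := by
  have hq : 0 < t ^ 2 * (4 * (1 + |t|)) + 1 := by positivity
  filter_upwards [rem_small h t z (c := c / (t ^ 2 * (4 * (1 + |t|)) + 1)) (by positivity)]
    with z' hz'
  set c' := c / (t ^ 2 * (4 * (1 + |t|)) + 1)
  have h1 : ‖err B W t z z'‖ ≤ 2 * (t ^ 2 * (c' * (2 * (1 + |t|) * ‖z' - z‖))) := by
    apply half_trick
    intro σ
    rw [err_eq h hW]
    refine (norm_add_le _ _).trans ?_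
    have h2 := kk_bound_const hz' σ
    have h3 := kk_bound_wt (M := 1 / 8 * ‖err B W t z z'‖) (by positivity) (Derr_bound (W := W) h t z z') σ
    have h4 : ‖t ^ 2 • ∫ η, kk σ η • rem B D t z z' η‖
        ≤ t ^ 2 * (c' * (2 * (1 + |t|) * ‖z' - z‖)) := by
      rw [norm_smul, Real.norm_of_nonneg (by positivity)]
      gcongr
    have := norm_nonneg (err B W t z z')
    linarith
  have e : c = c' * (t ^ 2 * (4 * (1 + |t|)) + 1) := by
    simp only [c']; field_simp
  have hc' : 0 < c' := by positivity
  refine h1.trans ?_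
  rw [e]
  have := mul_nonneg hc'.le (norm_nonneg (z' - z))
  nlinarith

lemma X0_deriv (h : C1Field B D) (hW : IsLinFlow B D W) (t : ℝ) (z : E3 × E3) :
    HasFDerivAt (fun z => X0 B (t, z)) (W (t, z) 0) z := by
  rw [hasFDerivAt_iff_isLittleO, Asymptotics.isLittleO_iff]
  intro c hc
  filter_upwards [err_small h hW t z hc] with z' hz'
  exact ((err B W t z z').norm_coe_le_norm 0).trans hz'

lemma V0_deriv (h : C1Field B D) (hW : IsLinFlow B D W) (t : ℝ) (z : E3 × E3) :
    HasFDerivAt (fun z => V0 B (t, z)) (DV B D W (t, z)) z := by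
  rw [hasFDerivAt_iff_isLittleO, Asymptotics.isLittleO_iff]
  intro c hc
  have hq : 0 < |t| * (2 * (1 + |t|)) + 1 := by positivity
  filter_upwards [err_small h hW t z hc,
    rem_small h t z (c := c / (2 * (|t| * (2 * (1 + |t|)) + 1))) (by positivity)] with z' h1 h2
  set c' := c / (2 * (|t| * (2 * (1 + |t|)) + 1))
  rw [V0_err h hW, norm_neg]
  refine (norm_add_le _ _).trans ?_
  have h3 := bound_wt (M := 1 / 8 * ‖err B W t z z'‖) (by positivity) (Derr_bound (W := W) h t z z')
  have h4 := bound_const h2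
  have h5 : ‖t • ∫ η, rem B D t z z' η‖ ≤ |t| * (c' * (2 * (1 + |t|) * ‖z' - z‖)) := by
    rw [norm_smul, Real.norm_eq_abs]
    gcongr
  have e : c = c' * (2 * (|t| * (2 * (1 + |t|)) + 1)) := by
    simp only [c']; field_simp
  have hc' : 0 < c' := by positivity
  have h6 : |t| * (c' * (2 * (1 + |t|) * ‖z' - z‖)) ≤ c / 2 * ‖z' - z‖ := by
    rw [e]
    have := mul_nonneg hc'.le (norm_nonneg (z' - z))
    nlinarith
  have := mul_nonneg hc.le (norm_nonneg (z' - z))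
  linarith

/-- Phase-space derivative of the transported datum. -/
def LF (f₀ : E3 × E3 → ℝ) (B : ℝ × E3 → E3) (D : ℝ × E3 → (E3 →L[ℝ] E3))
    (W : ℝ × E3 × E3 → C(unitInterval, E3 × E3 →L[ℝ] E3)) (p : ℝ × E3 × E3) :
    E3 × E3 →L[ℝ] ℝ :=
  (fderiv ℝ f₀ (X0 B p, V0 B p)).comp ((W p 0).prod (DV B D W p))

lemma FF_deriv (h : C1Field B D) (hW : IsLinFlow B D W) {f₀ : E3 × E3 → ℝ}
    (hf : ContDiff ℝ 1 f₀) (t : ℝ) (z : E3 × E3) :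
    HasFDerivAt (fun z => FF f₀ B (t, z)) (LF f₀ B D W (t, z)) z := by
  have h1 : HasFDerivAt f₀ (fderiv ℝ f₀ (X0 B (t, z), V0 B (t, z))) (X0 B (t, z), V0 B (t, z)) :=
    (hf.differentiable (by norm_num) _).hasFDerivAt
  exact h1.comp z ((X0_deriv h hW t z).prodMk (V0_deriv h hW t z))

lemma LF_cont (h : C1Field B D) (hW : IsLinFlow B D W) {f₀ : E3 × E3 → ℝ}
    (hf : ContDiff ℝ 1 f₀) : Continuous (LF f₀ B D W) := by
  unfold LF
  have h1 : Continuous (fderiv ℝ f₀) := hf.continuous_fderiv (by norm_num)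
  have h2 := (X0_cont h.toGoodField le_rfl).prodMk (V0_cont h.toGoodField le_rfl)
  have h3 := (W_joint_cont hW).comp
    (by fun_prop : Continuous (fun p : ℝ × E3 × E3 => (p, (0 : unitInterval))))
  have h4 := DV_cont h hW
  refine (h1.comp h2).clm_comp ?_
  exact (ContinuousLinearMap.prodₗᵢ ℝ).continuous.comp (h3.prodMk h4)

end


/-! ## Part 7: the flow property and the time derivative -/

/-- Force along the characteristic, as a function on the real line. -/
def uu (B : ℝ × E3 → E3) (p : ℝ × E3 × E3) (ξ : ℝ) : E3 :=
  B (p.1 * ξ, flowY B p (Set.projIcc 0 1 zero_le_one ξ))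

/-- Primitive of a function. -/
def NN (u : ℝ → E3) (s : ℝ) : E3 := ∫ ξ in (0 : ℝ)..s, u ξ

/-- Primitive of the first moment. -/
def MM (u : ℝ → E3) (s : ℝ) : E3 := ∫ ξ in (0 : ℝ)..s, ξ • u ξ

lemma NN_sub {u : ℝ → E3} (hu : Continuous u) (a b : ℝ) :
    ∫ ξ in a..b, u ξ = NN u b - NN u a := by
  unfold NN
  rw [intervalIntegral.integral_interval_sub_left] <;> exact hu.intervalIntegrable _ _

lemma moment_sub {u : ℝ → E3} (hu : Continuous u) (s a b : ℝ) :
    ∫ ξ in a..b, (ξ - s) • u ξ = MM u b - MM u a - s • (NN u b - NN u a) := by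
  have h1 : Continuous (fun ξ : ℝ => ξ • u ξ) := by fun_prop
  have h2 : Continuous (fun ξ : ℝ => s • u ξ) := by fun_prop
  simp only [sub_smul]
  rw [intervalIntegral.integral_sub (h1.intervalIntegrable _ _) (h2.intervalIntegrable _ _),
    intervalIntegral.integral_smul, NN_sub hu]
  unfold MM
  rw [intervalIntegral.integral_interval_sub_left] <;> exact h1.intervalIntegrable _ _

lemma kk_int {u : ℝ → E3} (hu : Continuous u) (σ : unitInterval) :
    ∫ η : unitInterval, kk σ η • u η = ∫ ξ in (σ : ℝ)..1, (ξ - σ) • u ξ := by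
  have h := ui_integral (fun x : ℝ => max (x - σ) 0 • u x)
  have hc : Continuous (fun x : ℝ => max (x - (σ : ℝ)) 0 • u x) := by fun_prop
  unfold kk
  rw [h, ← intervalIntegral.integral_add_adjacent_intervals
    (hc.intervalIntegrable 0 (σ : ℝ)) (hc.intervalIntegrable (σ : ℝ) 1)]
  have h1 : ∫ x in (0 : ℝ)..σ, max (x - (σ : ℝ)) 0 • u x = ∫ x in (0 : ℝ)..σ, 0 := by
    apply intervalIntegral.integral_congr
    intro x hx
    rw [Set.uIcc_of_le σ.2.1] at hx
    simp only
    rw [max_eq_right (by linarith [hx.2]), zero_smul]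
  rw [h1, intervalIntegral.integral_zero, zero_add]
  apply intervalIntegral.integral_congr
  intro x hx
  rw [Set.uIcc_of_le σ.2.2] at hx
  simp only
  rw [max_eq_left (by linarith [hx.1])]

section
variable {B : ℝ × E3 → E3} {δ : ℝ}

lemma uu_cont (h : GoodField δ B) (p : ℝ × E3 × E3) : Continuous (uu B p) := by
  unfold uu
  apply h.cont.comp
  exact Continuous.prodMk (by fun_prop) ((flowY B p).continuous.comp continuous_projIcc)

lemma uu_coe (p : ℝ × E3 × E3) (η : unitInterval) : uu B p η = B (p.1 * η, flowY B p η) := by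
  unfold uu
  rw [Set.projIcc_val]

lemma flow_formula (h : GoodField δ B) (hδ : δ ≤ 1 / 8) (p : ℝ × E3 × E3) (σ : unitInterval) :
    flowY B p σ = p.2.1 + (((σ : ℝ) - 1) * p.1) • p.2.2 + p.1 ^ 2 •
      (∫ ξ in (σ : ℝ)..1, (ξ - σ) • uu B p ξ) := by
  rw [(h.isFlow hδ).eq, ← kk_int (uu_cont h p)]
  simp only [uu_coe]

lemma flow_formula' (h : GoodField δ B) (hδ : δ ≤ 1 / 8) (p : ℝ × E3 × E3) (σ : unitInterval) :
    flowY B p σ = p.2.1 + (((σ : ℝ) - 1) * p.1) • p.2.2 + p.1 ^ 2 •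
      (MM (uu B p) 1 - MM (uu B p) σ - (σ : ℝ) • (NN (uu B p) 1 - NN (uu B p) σ)) := by
  rw [flow_formula h hδ, moment_sub (uu_cont h p)]

lemma V0_formula (_h : GoodField δ B) (p : ℝ × E3 × E3) :
    V0 B p = p.2.2 - p.1 • NN (uu B p) 1 := by
  unfold V0 NN
  rw [← ui_integral (uu B p)]
  simp only [uu_coe]

/-- Velocity along the characteristic. -/
def VV (B : ℝ × E3 → E3) (p : ℝ × E3 × E3) (a : unitInterval) : E3 :=
  p.2.2 - p.1 • ∫ ξ in (a : ℝ)..1, uu B p ξ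

lemma flow_prop (h : GoodField δ B) (hδ : δ ≤ 1 / 8) (p : ℝ × E3 × E3) (a : unitInterval) :
    X0 B (a * p.1, flowY B p a, VV B p a) = X0 B p ∧
    V0 B (a * p.1, flowY B p a, VV B p a) = V0 B p := by
  set q : ℝ × E3 × E3 := (a * p.1, flowY B p a, VV B p a) with hq
  set u := uu B p with hu
  have huc : Continuous u := uu_cont h p
  let Y' : C(unitInterval, E3) := ⟨fun σ => flowY B p (a * σ), by fun_prop⟩
  have hY' : ∀ σ, Y' σ = flowY B p (a * σ) := fun σ => rfl
  have hB : ∀ η : unitInterval, B (q.1 * η, Y' η) = u (a * η) := by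
    intro η
    have := uu_coe (B := B) p (a * η)
    rw [Set.Icc.coe_mul] at this
    rw [hu, this, hY', hq]
    congr 2
    ring
  have hua : Continuous (fun ξ : ℝ => u (a * ξ)) := by fun_prop
  have hkey : Y' = flowY B q := by
    apply (h.isFlow hδ).uniq
    intro σ
    simp only [hB]
    rw [kk_int hua, hY', flow_formula' h hδ]
    have e1 : q.1 ^ 2 • ∫ ξ in (σ : ℝ)..1, (ξ - σ) • u (a * ξ)
        = p.1 ^ 2 • (MM u a - MM u (a * σ) - (a * σ : ℝ) • (NN u a - NN u (a * σ))) := by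
      have e2 := intervalIntegral.smul_integral_comp_mul_left (a := (σ : ℝ)) (b := 1)
        (f := fun ξ => (ξ - (a * σ : ℝ)) • u ξ) (a : ℝ)
      rw [mul_one, moment_sub huc] at e2
      rw [← e2, ← intervalIntegral.integral_smul, ← intervalIntegral.integral_smul,
        ← intervalIntegral.integral_smul]
      congr 1
      funext ξ
      simp only [smul_smul]
      congr 1
      simp only [hq]
      ring
    rw [e1]
    simp only [hq, VV]
    rw [flow_formula' h hδ, NN_sub huc, Set.Icc.coe_mul]
    simp only [← hu]
    module
  constructor
  · unfold X0
    rw [← hkey, hY']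
    congr 1
    exact mul_zero a
  · rw [V0_formula h p]
    unfold V0
    rw [← hkey]
    simp only [hB]
    rw [ui_integral (fun ξ : ℝ => u (a * ξ))]
    have e2 := intervalIntegral.smul_integral_comp_mul_left (a := 0) (b := 1) (f := u) (a : ℝ)
    rw [mul_one, mul_zero] at e2
    have e3 : q.1 • ∫ ξ in (0 : ℝ)..1, u (a * ξ) = p.1 • NN u a := by
      unfold NN
      rw [← e2, smul_smul, hq]
      congr 1
      ring
    rw [e3]
    simp only [hq, VV]
    rw [NN_sub huc]
    module

lemma FF_flow (h : GoodField δ B) (hδ : δ ≤ 1 / 8) (f₀ : E3 × E3 → ℝ) (p : ℝ × E3 × E3)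
    (a : unitInterval) :
    FF f₀ B (a * p.1, flowY B p a, VV B p a) = FF f₀ B p := by
  have h1 := flow_prop h hδ p a
  unfold FF
  rw [h1.1, h1.2]

lemma B_norm (h : GoodField δ B) (hδ : δ ≤ 1 / 8) (q : ℝ × E3) : ‖B q‖ ≤ 1 := by
  have h1 : ‖B q‖ ≤ _ := h.bd q.1 q.2
  have h2 := w2_le_one q.1
  have h3 := (w2_pos q.1).le
  have h4 := h.delta_nonneg
  nlinarith

/-- Position increment. -/
lemma flow_incr (h : GoodField δ B) (hδ : δ ≤ 1 / 8) (p : ℝ × E3 × E3) (σ : unitInterval) :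
    ‖flowY B p σ - p.2.1 + ((1 - (σ : ℝ)) * p.1) • p.2.2‖ ≤ ((1 - (σ : ℝ)) * |p.1|) ^ 2 := by
  have e : flowY B p σ - p.2.1 + ((1 - (σ : ℝ)) * p.1) • p.2.2
      = p.1 ^ 2 • ∫ ξ in (σ : ℝ)..1, (ξ - σ) • uu B p ξ := by
    rw [flow_formula h hδ]; module
  rw [e, norm_smul, Real.norm_of_nonneg (by positivity)]
  have h1 : ‖∫ ξ in (σ : ℝ)..1, (ξ - σ) • uu B p ξ‖ ≤ (1 - (σ : ℝ)) * |1 - (σ : ℝ)| := by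
    apply intervalIntegral.norm_integral_le_of_norm_le_const
    intro ξ hξ
    rw [Set.uIoc_of_le σ.2.2] at hξ
    rw [norm_smul, Real.norm_of_nonneg (by linarith [hξ.1])]
    have := B_norm h hδ (p.1 * ξ, flowY B p (Set.projIcc 0 1 zero_le_one ξ))
    have h3 : ‖uu B p ξ‖ ≤ 1 := this
    have h4 := norm_nonneg (uu B p ξ)
    have h5 := hξ.1
    have h6 := hξ.2
    nlinarith
  rw [abs_of_nonneg (by linarith [σ.2.2])] at h1
  calc p.1 ^ 2 * ‖∫ ξ in (σ : ℝ)..1, (ξ - σ) • uu B p ξ‖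
      ≤ p.1 ^ 2 * ((1 - (σ : ℝ)) * (1 - (σ : ℝ))) := by gcongr
    _ = _ := by rw [mul_pow, sq_abs]; ring

end


/-! ## Part 8: the time derivative and regularity of the transported datum -/

section
variable {B : ℝ × E3 → E3} {δ : ℝ}

lemma displ (h : GoodField δ B) (hδ : δ ≤ 1 / 8) (t₀ : ℝ) (x v : E3) {c : ℝ} (hc : 0 < c) :
    ∃ r > 0, ∀ (s t : ℝ) (a : unitInterval), |s - t₀| < r → |t - t₀| < r → s = a * t →
      ‖((flowY B (t, x, v) a, VV B (t, x, v) a) : E3 × E3) - (x, v)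
        + (t - s) • ((v, B (t₀, x)) : E3 × E3)‖ ≤ c * |t - s| := by
  obtain ⟨η, hη, hB⟩ := Metric.continuousAt_iff.1 (h.cont.continuousAt (x := (t₀, x))) c hc
  have hv : 0 < ‖v‖ + 1 := by positivity
  refine ⟨min (1 / 2) (min (c / 2) (η / (4 * (‖v‖ + 1)))), by positivity, ?_⟩
  set r := min (1 / 2 : ℝ) (min (c / 2) (η / (4 * (‖v‖ + 1)))) with hr
  intro s t a hs ht hst
  have r1 : r ≤ 1 / 2 := min_le_left _ _
  have r2 : r ≤ c / 2 := (min_le_right _ _).trans (min_le_left _ _)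
  have r3 : r ≤ η / (4 * (‖v‖ + 1)) := (min_le_right _ _).trans (min_le_right _ _)
  rw [le_div_iff₀ (by positivity)] at r3
  have hd : |t - s| < 2 * r := by
    have : t - s = (t - t₀) - (s - t₀) := by ring
    rw [this]
    linarith [abs_sub (t - t₀) (s - t₀)]
  have hd0 := abs_nonneg (t - s)
  have ha0 : (0 : ℝ) ≤ a := a.2.1
  have ha1 : (a : ℝ) ≤ 1 := a.2.2
  have e1 : (1 - (a : ℝ)) * t = t - s := by rw [hst]; ring
  have e2 : (1 - (a : ℝ)) * |t| = |t - s| := by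
    rw [← e1, abs_mul, abs_of_nonneg (a := 1 - (a : ℝ)) (by linarith)]
  have hu : ∀ ξ ∈ Set.uIoc (a : ℝ) 1, ‖uu B (t, x, v) ξ - B (t₀, x)‖ ≤ c := by
    intro ξ hξ
    rw [Set.uIoc_of_le ha1] at hξ
    have hξ0 : 0 ≤ ξ := by linarith [hξ.1]
    set σ : unitInterval := ⟨ξ, hξ0, hξ.2⟩ with hσ
    have e3 : uu B (t, x, v) ξ = B (t * ξ, flowY B (t, x, v) σ) := uu_coe (B := B) (t, x, v) σ
    rw [e3, ← dist_eq_norm]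
    apply le_of_lt
    apply hB
    have hle : (1 - ξ) * |t| ≤ |t - s| := by
      rw [← e2]; gcongr; exact hξ.1.le
    have hle0 : 0 ≤ (1 - ξ) * |t| := mul_nonneg (by linarith [hξ.2]) (abs_nonneg _)
    rw [Prod.dist_eq]
    apply max_lt
    · simp only
      rw [Real.dist_eq]
      have : t * ξ - t₀ = (t - t₀) - (1 - ξ) * t := by ring
      rw [this]
      have h5 := abs_sub (t - t₀) ((1 - ξ) * t)
      rw [abs_mul, abs_of_nonneg (a := 1 - ξ) (by linarith [hξ.2])] at h5
      have : 0 ≤ ‖v‖ := norm_nonneg v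
      have : 0 < r := by linarith
      nlinarith
    · simp only
      rw [dist_eq_norm]
      have h6 := flow_incr h hδ (t, x, v) σ
      simp only at h6
      have h7 : flowY B (t, x, v) σ - x = (flowY B (t, x, v) σ - x + ((1 - (σ : ℝ)) * t) • v)
        - ((1 - (σ : ℝ)) * t) • v := by abel
      rw [h7]
      refine (norm_sub_le _ _).trans_lt ?_
      rw [norm_smul, Real.norm_eq_abs, abs_mul, abs_of_nonneg (a := 1 - (σ : ℝ)) (by linarith [hξ.2])]
      have hσξ : (σ : ℝ) = ξ := rfl
      rw [hσξ] at h6 ⊢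
      have h8 : ((1 - ξ) * |t|) ^ 2 ≤ |t - s| := by nlinarith
      have h9 : (1 - ξ) * |t| * ‖v‖ ≤ |t - s| * ‖v‖ := by gcongr
      have h10 : |t - s| * (‖v‖ + 1) ≤ 2 * r * (‖v‖ + 1) := by gcongr
      nlinarith
  have huc := uu_cont h (t, x, v)
  have e4 : VV B (t, x, v) a - v + (t - s) • B (t₀, x)
      = -(t • ∫ ξ in (a : ℝ)..1, (uu B (t, x, v) ξ - B (t₀, x))) := by
    rw [intervalIntegral.integral_sub (huc.intervalIntegrable _ _)
      (continuous_const.intervalIntegrable _ _), intervalIntegral.integral_const, ← e1]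
    unfold VV
    simp only
    module
  have h1 : ‖VV B (t, x, v) a - v + (t - s) • B (t₀, x)‖ ≤ c * |t - s| := by
    rw [e4, norm_neg, norm_smul, Real.norm_eq_abs]
    have := intervalIntegral.norm_integral_le_of_norm_le_const hu
    rw [abs_of_nonneg (a := 1 - (a : ℝ)) (by linarith)] at this
    calc |t| * _ ≤ |t| * (c * (1 - a)) := by gcongr
      _ = _ := by rw [← e2]; ring
  have h2 : ‖flowY B (t, x, v) a - x + (t - s) • v‖ ≤ c * |t - s| := by
    have h6 := flow_incr h hδ (t, x, v) a
    simp only at h6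
    rw [e1, e2] at h6
    nlinarith
  rw [Prod.norm_def]
  exact max_le h2 h1

end

section
variable {B : ℝ × E3 → E3} {D : ℝ × E3 → (E3 →L[ℝ] E3)}
  {W : ℝ × E3 × E3 → C(unitInterval, E3 × E3 →L[ℝ] E3)} {f₀ : E3 × E3 → ℝ}

lemma time_unif (h : C1Field B D) (hW : IsLinFlow B D W) (hf : ContDiff ℝ 1 f₀) (t₀ : ℝ)
    (x v : E3) {c : ℝ} (hc : 0 < c) :
    ∃ r > 0, ∀ (s t : ℝ) (a : unitInterval), |s - t₀| < r → |t - t₀| < r → s = a * t →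
      ‖FF f₀ B (t, x, v) - FF f₀ B (s, x, v)
        + (t - s) * LF f₀ B D W (t₀, x, v) (v, B (t₀, x))‖ ≤ c * |t - s| := by
  have hδ : (1 / 8 : ℝ) ≤ 1 / 8 := le_rfl
  set L₀ := LF f₀ B D W (t₀, x, v) with hL₀
  set w : E3 × E3 := (v, B (t₀, x)) with hw
  set K := ‖w‖ + 1 + ‖L₀‖ with hK
  have hKpos : 0 < K := by positivity
  set c1 := min 1 (c / K) with hc1
  have hc1pos : 0 < c1 := by positivity
  have hc1K : c1 * K ≤ c := by
    rw [← le_div_iff₀ hKpos]; exact min_le_right _ _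
  have hc11 : c1 ≤ 1 := min_le_left _ _
  obtain ⟨r1, hr1, hdis⟩ := displ h.toGoodField hδ t₀ x v hc1pos
  obtain ⟨η, hη, hL⟩ := Metric.continuousAt_iff.1
    ((LF_cont h hW hf).continuousAt (x := (t₀, x, v))) c1 hc1pos
  refine ⟨min r1 (min η (η / (2 * K))), by positivity, ?_⟩
  intro s t a hs ht hst
  have hs1 := lt_of_lt_of_le hs (min_le_left _ _)
  have ht1 := lt_of_lt_of_le ht (min_le_left _ _)
  have hs2 := lt_of_lt_of_le hs ((min_le_right _ _).trans (min_le_left _ _))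
  have hs3 := lt_of_lt_of_le hs ((min_le_right _ _).trans (min_le_right _ _))
  have ht3 := lt_of_lt_of_le ht ((min_le_right _ _).trans (min_le_right _ _))
  have hz := hdis s t a hs1 ht1 hst
  set z' : E3 × E3 := (flowY B (t, x, v) a, VV B (t, x, v) a) with hz'
  set z : E3 × E3 := (x, v) with hzz
  have hd : |t - s| * K < η := by
    have : t - s = (t - t₀) - (s - t₀) := by ring
    have h2 := abs_sub (t - t₀) (s - t₀)
    rw [← this] at h2
    have h3 : |t - s| < 2 * (η / (2 * K)) := by linarith
    calc |t - s| * K < 2 * (η / (2 * K)) * K := by gcongr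
      _ = η := by field_simp
  have hd0 := abs_nonneg (t - s)
  have hzn : ‖z' - z‖ ≤ (‖w‖ + c1) * |t - s| := by
    have : z' - z = (z' - z + (t - s) • w) - (t - s) • w := by abel
    rw [this]
    refine (norm_sub_le _ _).trans ?_
    rw [norm_smul, Real.norm_eq_abs]
    linarith
  have hzη : ‖z' - z‖ < η := by
    refine lt_of_le_of_lt hzn (lt_of_le_of_lt ?_ hd)
    rw [mul_comm]
    gcongr
    rw [hK]
    linarith [norm_nonneg L₀]
  have hmv : ‖FF f₀ B (s, z') - FF f₀ B (s, z) - L₀ (z' - z)‖ ≤ c1 * ‖z' - z‖ := by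
    apply Convex.norm_image_sub_le_of_norm_hasFDerivWithin_le' (𝕜 := ℝ)
      (s := Metric.ball z η) (f := fun y => FF f₀ B (s, y)) (f' := fun y => LF f₀ B D W (s, y))
    · intro y _
      exact (FF_deriv h hW hf s y).hasFDerivWithinAt
    · intro y hy
      rw [← dist_eq_norm]
      apply le_of_lt
      apply hL
      rw [Prod.dist_eq]
      exact max_lt (by simpa [Real.dist_eq] using hs2) hy
    · exact convex_ball _ _
    · exact Metric.mem_ball_self hη
    · rw [Metric.mem_ball, dist_eq_norm]; exact hzη
  have hfl : FF f₀ B (s, z') = FF f₀ B (t, z) := by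
    have := FF_flow h.toGoodField hδ f₀ (t, x, v) a
    rw [← this, hst]
  have e : FF f₀ B (t, z) - FF f₀ B (s, z) + (t - s) * L₀ w
      = (FF f₀ B (s, z') - FF f₀ B (s, z) - L₀ (z' - z)) + L₀ (z' - z + (t - s) • w) := by
    rw [hfl, map_add, map_smul, smul_eq_mul]; ring
  change ‖FF f₀ B (t, z) - FF f₀ B (s, z) + (t - s) * L₀ w‖ ≤ _
  rw [e]
  refine (norm_add_le _ _).trans ?_
  have h5 := L₀.le_opNorm (z' - z + (t - s) • w)
  have h6 : ‖L₀‖ * ‖z' - z + (t - s) • w‖ ≤ ‖L₀‖ * (c1 * |t - s|) := by gcongr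
  have h7 : c1 * ‖z' - z‖ ≤ c1 * ((‖w‖ + c1) * |t - s|) := by gcongr
  have h8 : c1 * ((‖w‖ + c1) * |t - s|) ≤ c1 * ((‖w‖ + 1) * |t - s|) := by gcongr
  have h9 : c1 * K * |t - s| ≤ c * |t - s| := by gcongr
  have h10 : c1 * K * |t - s| = c1 * ((‖w‖ + 1) * |t - s|) + ‖L₀‖ * (c1 * |t - s|) := by
    rw [hK]; ring
  linarith

/-- Two nearby times are related by a contraction factor. -/
lemma ratio (t₀ t : ℝ) (h : t₀ ≠ 0 → |t - t₀| < |t₀|) :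
    (∃ a : unitInterval, t₀ = a * t) ∨ (∃ a : unitInterval, t = a * t₀) := by
  by_cases h0 : t₀ = 0
  · left; exact ⟨0, by simp [h0]⟩
  have h1 := h h0
  have key : 0 < t / t₀ := by
    have : |t / t₀ - 1| < 1 := by
      have e : t / t₀ - 1 = (t - t₀) / t₀ := by field_simp
      rw [e, abs_div, div_lt_one (abs_pos.2 h0)]
      exact h1
    linarith [(abs_lt.1 this).1]
  have ht : t ≠ 0 := by rintro rfl; simp at key
  rcases le_total (t / t₀) 1 with h2 | h2
  · right
    exact ⟨⟨t / t₀, key.le, h2⟩, by simp only; field_simp⟩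
  · left
    refine ⟨⟨t₀ / t, ?_, ?_⟩, by simp only; field_simp⟩
    · rw [← inv_div]; positivity
    · rw [← inv_div]; exact inv_le_one_of_one_le₀ h2

lemma FF_time (h : C1Field B D) (hW : IsLinFlow B D W) (hf : ContDiff ℝ 1 f₀) (t₀ : ℝ)
    (x v : E3) :
    HasDerivAt (fun t => FF f₀ B (t, x, v)) (-(LF f₀ B D W (t₀, x, v) (v, B (t₀, x)))) t₀ := by
  rw [hasDerivAt_iff_isLittleO, Asymptotics.isLittleO_iff]
  intro c hc
  obtain ⟨r, hr, H⟩ := time_unif h hW hf t₀ x v hc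
  have hev : ∀ᶠ t in 𝓝 t₀, |t - t₀| < r ∧ (t₀ ≠ 0 → |t - t₀| < |t₀|) := by
    apply Filter.Eventually.and
    · exact Metric.ball_mem_nhds t₀ hr
    · by_cases h0 : t₀ = 0
      · simp [h0]
      · filter_upwards [Metric.ball_mem_nhds t₀ (abs_pos.2 h0)] with t ht _
        exact ht
  filter_upwards [hev] with t ht
  have h00 : |t₀ - t₀| < r := by simpa using hr
  rcases ratio t₀ t ht.2 with ⟨a, ha⟩ | ⟨a, ha⟩
  · have := H t₀ t a h00 ht.1 ha
    rw [Real.norm_eq_abs (t - t₀), smul_eq_mul]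
    refine le_of_eq_of_le (congrArg norm ?_) this
    ring
  · have := H t t₀ a ht.1 h00 ha
    rw [Real.norm_eq_abs (t - t₀), smul_eq_mul, abs_sub_comm, ← norm_neg]
    refine le_of_eq_of_le (congrArg norm ?_) this
    ring

lemma FF_strict (h : C1Field B D) (hW : IsLinFlow B D W) (hf : ContDiff ℝ 1 f₀)
    (p : ℝ × E3 × E3) :
    HasStrictFDerivAt (FF f₀ B)
      ((ContinuousLinearMap.toSpanSingleton ℝ (-(LF f₀ B D W p (p.2.2, B (p.1, p.2.1))))).coprod
        (LF f₀ B D W p)) p := by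
  have hLc := LF_cont h hW hf
  have hTc : Continuous (fun q : ℝ × E3 × E3 => ContinuousLinearMap.toSpanSingleton ℝ
      (-(LF f₀ B D W q (q.2.2, B (q.1, q.2.1))))) := by
    have h1 : Continuous (fun q : ℝ × E3 × E3 => LF f₀ B D W q (q.2.2, B (q.1, q.2.1))) := by
      apply hLc.clm_apply
      exact Continuous.prodMk (by fun_prop) (h.cont.comp (by fun_prop))
    exact (ContinuousLinearMap.toSpanSingletonLE ℝ ℝ ℝ).continuous_of_finiteDimensional.comp h1.neg
  have := hasStrictFDerivAt_uncurry_coprod (𝕜 := ℝ) (u := p)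
    (f := fun t z => FF f₀ B (t, z))
    (f₁ := fun t z => ContinuousLinearMap.toSpanSingleton ℝ
      (-(LF f₀ B D W (t, z) (z.2, B (t, z.1)))))
    (f₂ := fun t z => LF f₀ B D W (t, z))
    (Filter.Eventually.of_forall fun q => (FF_time h hW hf q.1 q.2.1 q.2.2).hasFDerivAt)
    (Filter.Eventually.of_forall fun q => FF_deriv h hW hf q.1 q.2)
    hTc.continuousAt hLc.continuousAt
  exact this

lemma FF_smooth (h : C1Field B D) (hW : IsLinFlow B D W) (hf : ContDiff ℝ 1 f₀) :
    ContDiff ℝ 1 (FF f₀ B) := by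
  rw [contDiff_one_iff_fderiv]
  refine ⟨fun p => (FF_strict h hW hf p).hasFDerivAt.differentiableAt, ?_⟩
  rw [continuous_iff_continuousAt]
  intro p
  have hLc := LF_cont h hW hf
  have h1 : Continuous (fun q : ℝ × E3 × E3 => LF f₀ B D W q (q.2.2, B (q.1, q.2.1))) := by
    apply hLc.clm_apply
    exact Continuous.prodMk (by fun_prop) (h.cont.comp (by fun_prop))
  have hTc : Continuous (fun q : ℝ × E3 × E3 => ContinuousLinearMap.toSpanSingleton ℝ
      (-(LF f₀ B D W q (q.2.2, B (q.1, q.2.1))))) :=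
    (ContinuousLinearMap.toSpanSingletonLE ℝ ℝ ℝ).continuous_of_finiteDimensional.comp h1.neg
  have e : fderiv ℝ (FF f₀ B) = fun q => (ContinuousLinearMap.toSpanSingleton ℝ
      (-(LF f₀ B D W q (q.2.2, B (q.1, q.2.1))))).coprod (LF f₀ B D W q) :=
    funext fun q => (FF_strict h hW hf q).hasFDerivAt.fderiv
  rw [e]
  apply Continuous.continuousAt
  have e2 : (fun q : ℝ × E3 × E3 => (ContinuousLinearMap.toSpanSingleton ℝ
      (-(LF f₀ B D W q (q.2.2, B (q.1, q.2.1))))).coprod (LF f₀ B D W q))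
      = fun q => (ContinuousLinearMap.toSpanSingleton ℝ
      (-(LF f₀ B D W q (q.2.2, B (q.1, q.2.1))))).comp (ContinuousLinearMap.fst ℝ ℝ (E3 × E3))
      + (LF f₀ B D W q).comp (ContinuousLinearMap.snd ℝ ℝ (E3 × E3)) := by
    funext q
    ext <;> simp
  rw [e2]
  exact (hTc.clm_comp continuous_const).add (hLc.clm_comp continuous_const)

lemma FF_pde (h : C1Field B D) (hW : IsLinFlow B D W) (hf : ContDiff ℝ 1 f₀) (t : ℝ)
    (x v : E3) : fderiv ℝ (FF f₀ B) (t, x, v) (1, v, B (t, x)) = 0 := by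
  rw [(FF_strict h hW hf (t, x, v)).hasFDerivAt.fderiv]
  simp

end


/-! ## Part 9: assembly -/

lemma goodData_of {ε R : ℝ} {f₀ : E3 × E3 → ℝ} (h0 : ∀ z, 0 ≤ f₀ z) (h1 : ContDiff ℝ 1 f₀)
    (h2 : ∀ x v : E3, f₀ (x, v) ≠ 0 → ‖x‖ ≤ R ∧ ‖v‖ ≤ R)
    (h3 : ∀ z, |f₀ z| ≤ ε ∧ ‖fderiv ℝ f₀ z‖ ≤ ε) : GoodData ε R f₀ where
  cont := h1.continuous
  nonneg := h0
  supp := h2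
  bd := fun z => (h3 z).1
  lip := by
    intro z z'
    rw [← Real.norm_eq_abs]
    exact convex_univ.norm_image_sub_le_of_norm_fderiv_le (𝕜 := ℝ)
      (fun y _ => (h1.differentiable one_ne_zero) y) (fun y _ => (h3 y).2)
      (Set.mem_univ z') (Set.mem_univ z)

lemma FF_zero {B : ℝ × E3 → E3} {δ : ℝ} (h : GoodField δ B) (hδ : δ ≤ 1 / 8)
    (f₀ : E3 × E3 → ℝ) (x v : E3) : FF f₀ B (0, x, v) = f₀ (x, v) := by
  unfold FF X0 V0
  rw [(h.isFlow hδ).eq]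
  simp

lemma w3_eq {t : ℝ} (ht : 0 ≤ t) : w3 t = (1 + t) ^ (-(3 : ℝ)) := by
  unfold w3
  rw [abs_of_nonneg ht, Real.rpow_neg (by linarith)]
  congr 1
  exact_mod_cast (Real.rpow_natCast (1 + t) 3).symm

lemma main_thm
    (β : ℝ) (hβ : β = 1 ∨ β = -1) (R : ℝ) (hR : 0 < R) :
    ∃ ε C : ℝ, 0 < ε ∧ 0 < C ∧
      ∀ f₀ : E3 × E3 → ℝ,
        (∀ z, 0 ≤ f₀ z) →
        ContDiff ℝ 1 f₀ →
        (∀ x v : E3, f₀ (x, v) ≠ 0 → ‖x‖ ≤ R ∧ ‖v‖ ≤ R) →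
        (∀ z, |f₀ z| ≤ ε ∧ ‖fderiv ℝ f₀ z‖ ≤ ε) →
        ∃ F : ℝ × E3 × E3 → ℝ,
          IsGlobalVPSolution β F ∧
          (∀ x v, F (0, x, v) = f₀ (x, v)) ∧
          (∀ t : ℝ, 0 ≤ t → ∀ x : E3,
            vpDensity F t x ≤ C * (1 + t) ^ (-(3 : ℝ))) := by
  have hβ1 : |β| = 1 := by rcases hβ with rfl | rfl <;> simp
  have hk : 0 < kap R := kap_pos hR
  have hM : 0 < Mc R := Mc_pos hR
  set ε := 1 / (8 * (kap R * Mc R)) with hε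
  have hεp : 0 < ε := by positivity
  have hA : ε * kap R * Mc R ≤ 1 / 8 := by
    rw [hε]; apply le_of_eq; field_simp
  refine ⟨ε, ε * kap R, hεp, by positivity, ?_⟩
  intro f₀ h0 h1 h2 h3
  have hf := goodData_of h0 h1 h2 h3
  obtain ⟨B, hB, hfix⟩ := exists_field hβ1 hR hA hf
  have hδ : (1 / 8 : ℝ) ≤ 1 / 8 := le_rfl
  have hdens := goodDens hB hδ hR hf
  obtain ⟨D, hD⟩ := newB_C1 hβ1 hdens hR hA
  rw [hfix] at hD
  obtain ⟨W, hW1, hW2⟩ := exists_W hD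
  have hW : IsLinFlow B D W := ⟨hW1, hW2⟩
  refine ⟨FF f₀ B, ?_, FF_zero hB hδ f₀, ?_⟩
  · refine ⟨fun _ => h0 _, FF_smooth hD hW h1, ?_, ?_⟩
    · intro t x v ht
      have e : β • vpField (FF f₀ B) t x = B (t, x) := by
        rw [vpField_eq]
        have := congrFun hfix (t, x)
        rw [← this]
        simp only [newB]
        rw [abs_of_nonneg ht]
      rw [e]
      exact FF_pde hD hW h1 t x v
    · intro t ht
      rw [isBounded_iff_forall_norm_le]
      refine ⟨max t (max ((R + 2) * (1 + t)) (R + 1)), ?_⟩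
      rintro ⟨s, x, v⟩ ⟨hs0, hs1, hF⟩
      simp only at hs0 hs1
      obtain ⟨hv, hx⟩ := supp_bound hB hδ h2 hF
      rw [abs_of_nonneg hs0] at hx
      rw [Prod.norm_def, Prod.norm_def]
      refine max_le_max ?_ (max_le_max ?_ hv)
      · simpa [abs_of_nonneg hs0] using hs1
      · refine hx.trans ?_
        gcongr
  · intro t ht x
    rw [← w3_eq ht]
    exact (le_abs_self _).trans (hdens.bd t x)

/-- Bardos–Degond small-data global existence for the
Vlasov–Poisson system, with the density decay `sup_x ρ(t,x) ≤ C(1+t)⁻³`. -/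
theorem bardos_degond_small_data
    (β : ℝ) (hβ : β = 1 ∨ β = -1) (R : ℝ) (hR : 0 < R) :
    ∃ ε C : ℝ, 0 < ε ∧ 0 < C ∧
      ∀ f₀ : E3 × E3 → ℝ,
        (∀ z, 0 ≤ f₀ z) →
        ContDiff ℝ 1 f₀ →
        (∀ x v : E3, f₀ (x, v) ≠ 0 → ‖x‖ ≤ R ∧ ‖v‖ ≤ R) →
        (∀ z, |f₀ z| ≤ ε ∧ ‖fderiv ℝ f₀ z‖ ≤ ε) →
        ∃ F : ℝ × E3 × E3 → ℝ,
          IsGlobalVPSolution β F ∧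
          (∀ x v, F (0, x, v) = f₀ (x, v)) ∧
          (∀ t : ℝ, 0 ≤ t → ∀ x : E3,
            vpDensity F t x ≤ C * (1 + t) ^ (-(3 : ℝ))) := by
  exact main_thm β hβ R hR
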